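/- arXiv:2305.03540 — 2 statements merged into one kernel-verified Lean document; each statement's English description precedes it below -/
import Mathlib

section
/- If G is a triangulated minimal S-imperfect graph, then G is Hamiltonian, i.e. G has a cycle passing through every vertex of G exactly once. -/
open SimpleGraph

/-- A set `T` of vertices is *S-independent* in `G` if any two distinct vertices of `T`
are at distance at least 3 in `G` (equivalently, no two of them lie in a common star
subgraph of `G`): they are non-adjacent and have no common neighbor. -/
def SimpleGraph.SIndepSet {V : Type*} (G : SimpleGraph V) (T : Set V) : Prop :=
  ∀ u ∈ T, ∀ w ∈ T, u ≠ w → ¬ G.Adj u w ∧ ∀ x : V, ¬ (G.Adj u x ∧ G.Adj x w)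

/-- `D` is a dominating set of `G`: every vertex is in `D` or adjacent to a vertex of `D`. -/
def SimpleGraph.DominatingSet {V : Type*} (G : SimpleGraph V) (D : Finset V) : Prop :=
  ∀ v : V, v ∈ D ∨ ∃ d ∈ D, G.Adj d v

/-- `α_S(G)`: the maximum size of an S-independent set of vertices of `G`. -/
noncomputable def alphaS {V : Type*} (G : SimpleGraph V) : ℕ :=
  sSup {n | ∃ T : Finset V, G.SIndepSet ↑T ∧ T.card = n}

/-- `θ_S(G)`: the domination number of `G`, i.e. the minimum size of a dominating set
(equivalently, the minimum number of stars needed to cover all vertices of `G`). -/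
noncomputable def thetaS {V : Type*} (G : SimpleGraph V) : ℕ :=
  sInf {n | ∃ D : Finset V, G.DominatingSet D ∧ D.card = n}

/-- `G` is *S-perfect* if `α_S(H) = θ_S(H)` for every induced subgraph `H` of `G`
(induced on any subset of the vertices). -/
def SPerfect {V : Type*} (G : SimpleGraph V) : Prop :=
  ∀ s : Set V, alphaS (G.induce s) = thetaS (G.induce s)

/-- `G` is *minimal S-imperfect* if `α_S(G) ≠ θ_S(G)` and `G − v` is S-perfect
for every vertex `v` of `G`. -/
def MinSImperfect {V : Type*} (G : SimpleGraph V) : Prop :=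
  alphaS G ≠ thetaS G ∧ ∀ v : V, SPerfect (G.induce {v}ᶜ)

/-- `G` is *triangulated* (chordal): it has no induced cycle of length at least 4. -/
def Chordal {V : Type*} (G : SimpleGraph V) : Prop :=
  ∀ n : ℕ, 4 ≤ n → ∀ s : Set V, ¬ Nonempty (G.induce s ≃g SimpleGraph.cycleGraph n)

/-- A relation `R x i` (read as: the edge `x` contains the point `i`) has an odd special
cycle: cyclically arranged points and edges, an odd number `m ≥ 3` of each, such that every edge
of the arrangement contains exactly two points of it, namely the two neighbouring ones. -/
def HasOddSpecialCycle {X I : Type*} (R : X → I → Prop) : Prop :=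
  ∃ (m : ℕ) (a : ℕ → I) (y : ℕ → X), Odd m ∧ 3 ≤ m ∧
    ∀ s < m, ∀ t < m, R (y t) (a s) ↔ s = t ∨ s = t + 1 ∨ (s = 0 ∧ t + 1 = m)

/-- A shortest odd closed sequence of adjacent vertices has no repeated vertex. -/
lemma exists_injOn_odd_closed_of_odd_closed {I : Type*} (G : SimpleGraph I) :
    ∀ (m : ℕ) (w : ℕ → I), Odd m → w m = w 0 → (∀ i < m, G.Adj (w i) (w (i + 1))) →
    ∃ (m : ℕ) (w : ℕ → I), Odd m ∧ w m = w 0 ∧ (∀ i < m, G.Adj (w i) (w (i + 1))) ∧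
      ∀ i j, i < j → j < m → w i ≠ w j := by
  intro m
  induction m using Nat.strong_induction_on with
  | _ m ih =>
    intro w hm h0 hadj
    by_cases hinj : ∀ i j, i < j → j < m → w i ≠ w j
    · exact ⟨m, w, hm, h0, hadj, hinj⟩
    push Not at hinj
    obtain ⟨i, j, hij, hjm, hw⟩ := hinj
    rcases Nat.even_or_odd (j - i) with hd | hd
    · refine ih (m - (j - i)) (by omega) (fun t => if t ≤ i then w t else w (t + (j - i)))
        (by grind) ?_ ?_
      · have h1 : ¬ (m - (j - i) ≤ i) := by omega
        have h2 : m - (j - i) + (j - i) = m := by omega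
        simp [h1, h2, h0]
      · intro t ht
        rcases lt_trichotomy t i with h | h | h
        · have h1 : t ≤ i := by omega
          have h2 : t + 1 ≤ i := by omega
          simpa [h1, h2] using hadj t (by omega)
        · have h1 : t ≤ i := by omega
          have h2 : ¬ t + 1 ≤ i := by omega
          have h3 : t + 1 + (j - i) = j + 1 := by omega
          simp only [if_pos h1, if_neg h2, h3]
          rw [h, hw]
          exact hadj j hjm
        · have h1 : ¬ t ≤ i := by omega
          have h2 : ¬ t + 1 ≤ i := by omega
          have h3 : t + 1 + (j - i) = t + (j - i) + 1 := by omega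
          simpa [h1, h2, h3] using hadj (t + (j - i)) (by omega)
    · refine ih (j - i) (by omega) (fun t => w (i + t)) hd ?_ ?_
      · have h1 : i + (j - i) = j := by omega
        simp [h1, hw]
      · intro t ht
        exact hadj (i + t) (by omega)

/-- Without odd special cycles, every finite set of points has a 2-coloring such that every edge
with at least two points in the set sees both colors. -/
lemma exists_bicoloring {X I : Type*} {R : X → I → Prop} (hR : ¬ HasOddSpecialCycle R)
    (B : Finset I) : ∃ c : I → Bool, ∀ y, (∃ i ∈ B, ∃ j ∈ B, i ≠ j ∧ R y i ∧ R y j) →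
      ∃ i ∈ B, ∃ j ∈ B, R y i ∧ R y j ∧ c i ≠ c j := by
  classical
  induction B using Finset.strongInduction with
  | _ B ih =>
    rcases B.eq_empty_or_nonempty with rfl | ⟨r, hr⟩
    · exact ⟨fun _ => true, by simp⟩
    let G : SimpleGraph I :=
      { Adj := fun i j => i ≠ j ∧ i ∈ B ∧ j ∈ B ∧ ∃ y, ∀ l ∈ B, R y l ↔ l = i ∨ l = j
        symm := ⟨fun i j ⟨h1, h2, h3, y, h4⟩ => ⟨h1.symm, h3, h2, y, by simpa [or_comm] using h4⟩⟩
        loopless := ⟨fun i h => h.1 rfl⟩ }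
    have hcol : G.Colorable 2 := by
      rw [SimpleGraph.two_colorable_iff_forall_loop_even]
      intro u p
      by_contra hodd
      rw [Nat.not_even_iff_odd] at hodd
      obtain ⟨m, w, hm, h0, hadj, hinj⟩ := exists_injOn_odd_closed_of_odd_closed G p.length
        p.getVert hodd (by simp) (fun i hi => p.adj_getVert_succ hi)
      have hm3 : 3 ≤ m := by
        obtain ⟨q, rfl⟩ := hm
        rcases q with _ | q
        · exact absurd h0.symm (hadj 0 (by omega)).1
        · omega
      have hy : ∀ t, ∃ y, t < m → ∀ l ∈ B, R y l ↔ l = w t ∨ l = w (t + 1) := by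
        intro t
        by_cases ht : t < m
        · obtain ⟨-, -, -, y, h⟩ := hadj t ht
          exact ⟨y, fun _ => h⟩
        · obtain ⟨-, -, -, y, h⟩ := hadj 0 (by omega)
          exact ⟨y, fun h => absurd h ht⟩
      choose y hy using hy
      refine hR ⟨m, w, y, hm, hm3, fun s hs t ht => ?_⟩
      rw [hy t ht _ (hadj s hs).2.1]
      have hinj' : ∀ i < m, ∀ j < m, w i = w j ↔ i = j := by
        intro i hi j hj
        refine ⟨fun h => ?_, fun h => by rw [h]⟩
        rcases lt_trichotomy i j with h' | h' | h'
        · exact absurd h (hinj i j h' hj)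
        · exact h'
        · exact absurd h.symm (hinj j i h' hi)
      rw [hinj' s hs t ht]
      by_cases htm : t + 1 = m
      · rw [htm, h0, hinj' s hs 0 (by omega)]
        omega
      · rw [hinj' s hs (t + 1) (by omega)]
        omega
    obtain ⟨c0⟩ : Nonempty (G.Coloring Bool) :=
      (SimpleGraph.colorable_iff_exists_bdd_nat_coloring 2).1 hcol |>.elim fun _ _ =>
        ⟨hcol.toColoring (by simp)⟩
    obtain ⟨x, hx, hmax⟩ := (B.filter (fun v => G.Reachable v r)).exists_max_image
      (fun v => G.dist v r) ⟨r, by simp [hr]⟩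
    simp only [Finset.mem_filter] at hx hmax
    obtain ⟨c, hc⟩ := ih (B.erase x) (Finset.erase_ssubset hx.1)
    have key : ∀ d v, G.Reachable v r → v ∈ B → G.dist v r = d → v ≠ x →
        xor (c v) (c0 v) = xor (c r) (c0 r) := by
      intro d
      induction d using Nat.strong_induction_on with
      | _ d ihd =>
        intro v hv hvB hd hvx
        obtain ⟨p, hp⟩ := hv.exists_walk_length_eq_dist
        cases p with
        | nil => rfl
        | @cons _ u _ hvu q =>
          have hq : G.dist u r ≤ q.length := G.dist_le q
          have hp' : q.length + 1 = G.dist v r := by simpa using hp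
          have hle := hmax v ⟨hvB, hv⟩
          have hux : u ≠ x := by
            rintro rfl
            omega
          rw [← ihd (G.dist u r) (by omega) u ⟨q⟩ hvu.2.2.1 rfl hux]
          obtain ⟨y, hy⟩ := hvu.2.2.2
          have h1 := c0.valid hvu
          have h2 : c v ≠ c u := by
            obtain ⟨i, hi, j, hj, hri, hrj, hcij⟩ := hc y ⟨v, by simp [hvx, hvB], u,
              by simp [hux, hvu.2.2.1], hvu.1, (hy v hvB).2 (Or.inl rfl),
              (hy u hvu.2.2.1).2 (Or.inr rfl)⟩
            rw [hy i (Finset.mem_of_mem_erase hi)] at hri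
            rw [hy j (Finset.mem_of_mem_erase hj)] at hrj
            rcases hri with rfl | rfl <;> rcases hrj with rfl | rfl
            · exact absurd rfl hcij
            · exact hcij
            · exact hcij.symm
            · exact absurd rfl hcij
          revert h1 h2
          cases c v <;> cases c u <;> cases c0 v <;> cases c0 u <;> simp
    refine ⟨Function.update c x (xor (c0 x) (xor (c r) (c0 r))), fun y hy => ?_⟩
    by_cases h2 : ∃ i ∈ B.erase x, ∃ j ∈ B.erase x, i ≠ j ∧ R y i ∧ R y j
    · obtain ⟨i, hi, j, hj, h⟩ := hc y h2
      rw [Finset.mem_erase] at hi hj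
      exact ⟨i, hi.2, j, hj.2, by simpa [hi.1, hj.1] using h⟩
    have hu : ∃ u ∈ B, u ≠ x ∧ R y u ∧ R y x := by
      obtain ⟨i, hi, j, hj, hij, hri, hrj⟩ := hy
      grind
    obtain ⟨u, huB, hux, hyu, hyx⟩ := hu
    have hadj : G.Adj u x := by
      refine ⟨hux, huB, hx.1, y, fun l hl => ⟨fun h => ?_, ?_⟩⟩
      · grind
      · rintro (rfl | rfl) <;> assumption
    refine ⟨u, huB, x, hx.1, hyu, hyx, ?_⟩
    rw [Function.update_of_ne hux, Function.update_self]
    have h1 := key _ u (hadj.reachable.trans hx.2) huB rfl hux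
    have h3 := c0.valid hadj
    rw [← h1]
    revert h3
    cases c u <;> cases c0 u <;> cases c0 x <;> simp

/-- Without odd special cycles, if every edge contains at most `k` points, then the points can be
colored with `k` colors so that no edge contains two points of the same color. -/
lemma exists_strong_coloring {X J : Type*} [Fintype X] [Fintype J] {R : X → J → Prop}
    (hR : ¬ HasOddSpecialCycle R) (k : ℕ) [NeZero k]
    (hk : ∀ y, {j | R y j}.ncard ≤ k) :
    ∃ f : J → Fin k, ∀ y i j, R y i → R y j → f i = f j → i = j := by
  classical
  let N : X → Finset J := fun y => Finset.univ.filter (R y)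
  have hN : ∀ y, (N y).card ≤ k := by
    intro y
    rw [← Set.ncard_coe_finset]
    simpa [N] using hk y
  obtain ⟨f, hf⟩ := Finite.exists_max (fun f : J → Fin k => ∑ y, ((N y).image f).card)
  refine ⟨f, fun y₀ i j hi hj hij => ?_⟩
  by_contra hne
  have hlt : ((N y₀).image f).card < k := by
    refine lt_of_lt_of_le (lt_of_le_of_ne Finset.card_image_le fun h => ?_) (hN y₀)
    exact hne (Finset.card_image_iff.1 h (by simp [N, hi]) (by simp [N, hj]) hij)
  obtain ⟨q, hq⟩ : ∃ q, q ∉ (N y₀).image f := by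
    by_contra! h
    have : (N y₀).image f = Finset.univ := Finset.eq_univ_iff_forall.2 h
    simp [this] at hlt
  have hq' : ∀ l, R y₀ l → f l ≠ q := by
    simpa [N] using hq
  have hpq : f i ≠ q := hq' i hi
  obtain ⟨c, hc⟩ := exists_bicoloring hR (Finset.univ.filter fun l => f l = f i ∨ f l = q)
  simp only [Finset.mem_filter, Finset.mem_univ, true_and] at hc
  let f' : J → Fin k := fun l => if f l = f i ∨ f l = q then (if c l then f i else q) else f l
  have hsplit : ∀ g : J → Fin k, ∀ y, ((N y).image g).card =
      ((N y).image g \ {f i, q}).card + ((N y).image g ∩ {f i, q}).card :=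
    fun g y => (Finset.card_sdiff_add_card_inter _ _).symm
  have hout : ∀ y, (N y).image f \ {f i, q} ⊆ (N y).image f' \ {f i, q} := by
    intro y z hz
    simp only [Finset.mem_sdiff, Finset.mem_image, Finset.mem_insert, Finset.mem_singleton] at hz ⊢
    obtain ⟨⟨l, hl, rfl⟩, hz⟩ := hz
    exact ⟨⟨l, hl, by simp only [f', if_neg hz]⟩, hz⟩
  have htwo : ∀ y, (∃ l, (f l = f i ∨ f l = q) ∧ ∃ l', (f l' = f i ∨ f l' = q) ∧
      l ≠ l' ∧ R y l ∧ R y l') → ((N y).image f' ∩ {f i, q}).card = 2 := by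
    intro y hy
    obtain ⟨l, hl, l', hl', hyl, hyl', hcl⟩ := hc y hy
    have : (N y).image f' ∩ {f i, q} = {f i, q} := by
      rw [Finset.inter_eq_right]
      intro z hz
      have h1 : f' l = if c l then f i else q := if_pos hl
      have h2 : f' l' = if c l' then f i else q := if_pos hl'
      have h3 : f' l ∈ (N y).image f' := Finset.mem_image_of_mem _ (by simp [N, hyl])
      have h4 : f' l' ∈ (N y).image f' := Finset.mem_image_of_mem _ (by simp [N, hyl'])
      rw [h1] at h3
      rw [h2] at h4
      simp only [Finset.mem_insert, Finset.mem_singleton] at hz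
      rcases hz with rfl | rfl <;> revert h3 h4 hcl <;> cases c l <;> cases c l' <;>
        simp +contextual [-Finset.mem_image]
    rw [this, Finset.card_pair hpq]
  have hin : ∀ y, ((N y).image f ∩ {f i, q}).card ≤ ((N y).image f' ∩ {f i, q}).card := by
    intro y
    by_cases h : ∃ l, (f l = f i ∨ f l = q) ∧ ∃ l', (f l' = f i ∨ f l' = q) ∧
        l ≠ l' ∧ R y l ∧ R y l'
    · rw [htwo y h]
      exact (Finset.card_le_card Finset.inter_subset_right).trans Finset.card_le_two
    · rcases ((N y).image f ∩ {f i, q}).eq_empty_or_nonempty with he | ⟨z, hz⟩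
      · simp [he]
      · simp only [Finset.mem_inter, Finset.mem_image, Finset.mem_insert,
          Finset.mem_singleton] at hz
        obtain ⟨⟨l, hl, rfl⟩, hz⟩ := hz
        have h1 : ((N y).image f ∩ {f i, q}).card ≤ 1 := by
          rw [Finset.card_le_one_iff_subset_singleton]
          refine ⟨f l, fun z hz' => ?_⟩
          simp only [Finset.mem_inter, Finset.mem_image, Finset.mem_insert,
            Finset.mem_singleton] at hz'
          obtain ⟨⟨l', hl', rfl⟩, hz'⟩ := hz'
          by_contra hll
          refine h ⟨l, hz, l', hz', ?_, by simpa [N] using hl, by simpa [N] using hl'⟩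
          rintro rfl
          simp at hll
        refine h1.trans (Finset.card_pos.2 ⟨f' l, ?_⟩)
        simp only [Finset.mem_inter, Finset.mem_insert, Finset.mem_singleton]
        refine ⟨Finset.mem_image_of_mem _ hl, ?_⟩
        have h1 : f' l = if c l then f i else q := if_pos hz
        rw [h1]
        cases c l <;> simp
  have hstrict : ((N y₀).image f ∩ {f i, q}).card < ((N y₀).image f' ∩ {f i, q}).card := by
    rw [htwo y₀ ⟨i, Or.inl rfl, j, Or.inl hij.symm, hne, hi, hj⟩, Nat.lt_succ_iff,
      Finset.card_le_one_iff_subset_singleton]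
    refine ⟨f i, fun z hz => ?_⟩
    simp only [Finset.mem_inter, Finset.mem_insert, Finset.mem_singleton] at hz ⊢
    rcases hz.2 with h | rfl
    · exact h
    · exact absurd hz.1 hq
  refine absurd (hf f') (not_le.2 (Finset.sum_lt_sum (fun y _ => ?_) ⟨y₀, Finset.mem_univ _, ?_⟩))
  · rw [hsplit f, hsplit f']
    exact add_le_add (Finset.card_le_card (hout y)) (hin y)
  · rw [hsplit f, hsplit f']
    exact add_lt_add_of_le_of_lt (Finset.card_le_card (hout y₀)) hstrict

/-- A set of points is a packing if every edge contains at most one of them. -/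
def IsPacking {X I : Type*} (R : X → I → Prop) (T : Finset I) : Prop :=
  ∀ x, ∀ i ∈ T, ∀ j ∈ T, R x i → R x j → i = j

/-- Without odd special cycles, any set `S` of points has a packing and a cover by edges, the
cover being at most as large as the packing. -/
lemma exists_packing_cover {X I : Type*} [Fintype X] [Fintype I] {R : X → I → Prop}
    (hR : ¬ HasOddSpecialCycle R) (hcov : ∀ i, ∃ x, R x i) (S : Finset I) :
    ∃ T ⊆ S, ∃ D : Finset X, IsPacking R T ∧ (∀ i ∈ S, ∃ x ∈ D, R x i) ∧ D.card ≤ T.card := by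
  classical
  induction S using Finset.strongInduction with
  | _ S ih =>
    rcases S.eq_empty_or_nonempty with rfl | ⟨i₀, hi₀⟩
    · exact ⟨∅, le_rfl, ∅, by simp [IsPacking], by simp, le_rfl⟩
    obtain ⟨T₀, hT₀, hmax⟩ := (S.powerset.filter (IsPacking R)).exists_max_image Finset.card
      ⟨∅, by simp [IsPacking]⟩
    simp only [Finset.mem_filter, Finset.mem_powerset] at hT₀ hmax
    by_cases hx : ∃ x, ∀ T ⊆ S, IsPacking R T → T.card = T₀.card → ∃ i ∈ T, R x i
    · obtain ⟨x, hx⟩ := hx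
      obtain ⟨i, hi, hxi⟩ := hx T₀ hT₀.1 hT₀.2 rfl
      obtain ⟨T, hTS, D, hT, hD, hDT⟩ := ih (S.filter fun i => ¬ R x i) (by
        rw [Finset.filter_ssubset]
        exact ⟨i, hT₀.1 hi, by simpa using hxi⟩)
      have hTS' : T ⊆ S := hTS.trans (Finset.filter_subset _ _)
      have hlt : T.card < T₀.card := by
        refine lt_of_le_of_ne (hmax T ⟨hTS', hT⟩) fun h => ?_
        obtain ⟨j, hj, hxj⟩ := hx T hTS' hT h
        exact (Finset.mem_filter.1 (hTS hj)).2 hxj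
      refine ⟨T₀, hT₀.1, insert x D, hT₀.2, fun j hj => ?_, ?_⟩
      · by_cases hxj : R x j
        · exact ⟨x, by simp, hxj⟩
        · obtain ⟨z, hz, hzj⟩ := hD j (by simp [hj, hxj])
          exact ⟨z, by simp [hz], hzj⟩
      · have := Finset.card_insert_le x D
        omega
    · exfalso
      push Not at hx
      choose T hTS hT hcard hmiss using hx
      have hpos : 0 < T₀.card := by
        have := hmax {i₀} ⟨by simpa using hi₀, by simp [IsPacking]⟩
        simpa using this
      obtain ⟨x₀, hx₀⟩ := hcov i₀
      let J := (x : X) × T x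
      let R' : X → J → Prop := fun y j => R y j.2
      have hR' : ¬ HasOddSpecialCycle R' := by
        rintro ⟨m, a, y, hm, hm3, h⟩
        exact hR ⟨m, fun s => (a s).2, y, hm, hm3, h⟩
      have hdeg : ∀ y, {j | R' y j}.ncard ≤ Fintype.card X - 1 := by
        intro y
        rw [← Finset.card_univ, ← Finset.card_erase_of_mem (Finset.mem_univ y),
          ← Set.ncard_coe_finset]
        refine Set.ncard_le_ncard_of_injOn Sigma.fst ?_ ?_ (Finset.finite_toSet _)
        · rintro ⟨x, i, hi⟩ hj
          simp only [Finset.coe_erase, Finset.coe_univ]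
          refine ⟨trivial, ?_⟩
          rintro rfl
          exact hmiss _ i hi hj
        · rintro ⟨x, i, hi⟩ hj ⟨x', i', hi'⟩ hj' h
          obtain rfl : x = x' := h
          obtain rfl := hT x y i hi i' hi' hj hj'
          rfl
      have hJ : Fintype.card J = Fintype.card X * T₀.card := by
        simp [J, hcard]
      have hX : 0 < Fintype.card X := Fintype.card_pos_iff.2 ⟨x₀⟩
      obtain ⟨j₀⟩ : Nonempty J := by
        rw [← Fintype.card_pos_iff, hJ]
        positivity
      have hk : NeZero (Fintype.card X - 1) := by
        refine ⟨fun h0 => ?_⟩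
        obtain ⟨y, hy⟩ := hcov j₀.2
        have := hdeg y
        rw [h0, Nat.le_zero, Set.ncard_eq_zero (Set.toFinite _)] at this
        exact Set.notMem_empty j₀ (this ▸ hy)
      obtain ⟨f, hf⟩ := exists_strong_coloring hR' _ hdeg
      have hclass : ∀ c, (Finset.univ.filter fun j => f j = c).card ≤ T₀.card := by
        intro c
        have hinj : Set.InjOn (fun j : J => (j.2 : I))
            (Finset.univ.filter fun j => f j = c : Finset J) := by
          intro j hj j' hj' h
          simp only [Finset.coe_filter, Finset.mem_univ, true_and] at hj hj'
          obtain ⟨y, hy⟩ := hcov j.2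
          have hy' : R y j'.2 := by
            rw [← show (j.2 : I) = j'.2 from h]
            exact hy
          exact hf y j j' hy hy' (hj.trans hj'.symm)
        rw [← Finset.card_image_of_injOn hinj]
        refine hmax _ ⟨?_, ?_⟩
        · intro i hi
          simp only [Finset.mem_image] at hi
          obtain ⟨j, -, rfl⟩ := hi
          exact hTS _ j.2.2
        · intro x i hi i' hi' hxi hxi'
          simp only [Finset.mem_image, Finset.mem_filter, Finset.mem_univ, true_and] at hi hi'
          obtain ⟨j, hj, rfl⟩ := hi
          obtain ⟨j', hj', rfl⟩ := hi'
          rw [hf x j j' hxi hxi' (hj.trans hj'.symm)]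
      have hsum : Fintype.card J ≤ (Fintype.card X - 1) * T₀.card := by
        rw [← Finset.card_univ, Finset.card_eq_sum_card_fiberwise (f := f) (t := Finset.univ)
          (fun _ _ => by simp)]
        refine (Finset.sum_le_sum fun c _ => hclass c).trans ?_
        simp
      rw [hJ, Nat.sub_mul, one_mul] at hsum
      have : T₀.card ≤ Fintype.card X * T₀.card := Nat.le_mul_of_pos_left _ hX
      omega

/-- In a cycle graph, two vertices are adjacent iff they are cyclically consecutive. -/
lemma cycleGraph_adj_iff_val {n : ℕ} (i j : Fin n) (hn : 2 ≤ n) :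
    (SimpleGraph.cycleGraph n).Adj i j ↔ (i : ℕ) + 1 = j ∨ (j : ℕ) + 1 = i ∨
      ((i : ℕ) = 0 ∧ (j : ℕ) + 1 = n) ∨ ((j : ℕ) = 0 ∧ (i : ℕ) + 1 = n) := by
  rw [SimpleGraph.cycleGraph_adj']
  rcases lt_trichotomy i j with h | h | h
  · rw [Fin.coe_sub_iff_lt.2 h, Fin.coe_sub_iff_le.2 h.le]
    have : (i : ℕ) < j := h
    omega
  · subst h
    rw [Fin.coe_sub_iff_le.2 le_rfl]
    omega
  · rw [Fin.coe_sub_iff_lt.2 h, Fin.coe_sub_iff_le.2 h.le]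
    have : (j : ℕ) < i := h
    omega

/-- In a chordal graph, two distinct non-adjacent neighbours of `u` cannot be joined by a walk
whose inner vertices are outside the closed neighbourhood of `u`. -/
lemma Chordal.not_walk_avoiding {V : Type*} {G : SimpleGraph V} (hc : Chordal G) (u : V) :
    ∀ (k : ℕ) (w : ℕ → V), G.Adj u (w 0) → G.Adj u (w k) → w 0 ≠ w k → ¬ G.Adj (w 0) (w k) →
      (∀ i < k, w i = w (i + 1) ∨ G.Adj (w i) (w (i + 1))) →
      (∀ i, 0 < i → i < k → w i ≠ u ∧ ¬ G.Adj u (w i)) → False := by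
  intro k
  induction k using Nat.strong_induction_on with
  | _ k ih =>
    intro w h0 hk hne hnadj hstep hint
    have hinj : ∀ i j, i < j → j ≤ k → w i ≠ w j := by
      intro i j hij hjk hw
      have hk0 : ¬ (i = 0 ∧ j = k) := by
        rintro ⟨rfl, rfl⟩
        exact hne hw
      have h1 : ¬ (k - (j - i) ≤ i ∧ j ≠ k) := by omega
      have hlast : (if k - (j - i) ≤ i then w (k - (j - i)) else w (k - (j - i) + (j - i)))
          = w k := by
        split_ifs with h
        · obtain rfl : j = k := by omega
          have : j - (j - i) = i := by omega
          rw [this, hw]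
        · congr 1
          omega
      refine ih (k - (j - i)) (by omega) (fun t => if t ≤ i then w t else w (t + (j - i)))
        (by simpa using h0) ?_ ?_ ?_ ?_ ?_
      · simpa only [hlast] using hk
      · simpa only [hlast, Nat.zero_le, if_true] using hne
      · simpa only [hlast, Nat.zero_le, if_true] using hnadj
      · intro t ht
        rcases lt_trichotomy t i with h | h | h
        · simpa only [if_pos h.le, if_pos (show t + 1 ≤ i from h)] using hstep t (by omega)
        · have h2 : ¬ t + 1 ≤ i := by omega
          have h3 : t + 1 + (j - i) = j + 1 := by omega
          simp only [if_pos h.le, if_neg h2, h3]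
          rw [h, hw]
          exact hstep j (by omega)
        · have h2 : ¬ t + 1 ≤ i := by omega
          have h3 : t + 1 + (j - i) = t + (j - i) + 1 := by omega
          simp only [if_neg (not_le.2 h), if_neg h2, h3]
          exact hstep _ (by omega)
      · intro t ht0 ht
        split_ifs with h
        · exact hint t ht0 (by omega)
        · exact hint _ (by omega) (by omega)
    have hind : ∀ i j, i + 1 < j → j ≤ k → ¬ G.Adj (w i) (w j) := by
      intro i j hij hjk hw
      have hk0 : ¬ (i = 0 ∧ j = k) := by
        rintro ⟨rfl, rfl⟩
        exact hnadj hw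
      have hlast : (if k - (j - i - 1) ≤ i then w (k - (j - i - 1))
          else w (k - (j - i - 1) + (j - i - 1))) = w k := by
        rw [if_neg (by omega)]
        congr 1
        omega
      refine ih (k - (j - i - 1)) (by omega)
        (fun t => if t ≤ i then w t else w (t + (j - i - 1))) (by simpa using h0) ?_ ?_ ?_ ?_ ?_
      · simpa only [hlast] using hk
      · simpa only [hlast, Nat.zero_le, if_true] using hne
      · simpa only [hlast, Nat.zero_le, if_true] using hnadj
      · intro t ht
        rcases lt_trichotomy t i with h | h | h
        · simpa only [if_pos h.le, if_pos (show t + 1 ≤ i from h)] using hstep t (by omega)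
        · have h2 : ¬ t + 1 ≤ i := by omega
          have h3 : t + 1 + (j - i - 1) = j := by omega
          simp only [if_pos h.le, if_neg h2, h3]
          rw [h]
          exact Or.inr hw
        · have h2 : ¬ t + 1 ≤ i := by omega
          have h3 : t + 1 + (j - i - 1) = t + (j - i - 1) + 1 := by omega
          simp only [if_neg (not_le.2 h), if_neg h2, h3]
          exact hstep _ (by omega)
      · intro t ht0 ht
        split_ifs with h
        · exact hint t ht0 (by omega)
        · exact hint _ (by omega) (by omega)
    have hstep' : ∀ i < k, G.Adj (w i) (w (i + 1)) := fun i hi =>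
      (hstep i hi).resolve_left (hinj i (i + 1) (by omega) (by omega))
    have hk2 : 2 ≤ k := by
      rcases k with _ | _ | k
      · exact absurd rfl hne
      · exact absurd (hstep' 0 (by omega)) hnadj
      · omega
    have hwu : ∀ i ≤ k, w i ≠ u := by
      intro i hi
      rcases Nat.eq_zero_or_pos i with rfl | hi0
      · exact h0.ne'
      · rcases hi.lt_or_eq with h | rfl
        · exact (hint i hi0 h).1
        · exact hk.ne'
    have hadju : ∀ i ≤ k, G.Adj u (w i) ↔ i = 0 ∨ i = k := by
      intro i hi
      refine ⟨fun h => ?_, ?_⟩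
      · by_contra hcon
        exact (hint i (by omega) (by omega)).2 h
      · rintro (rfl | rfl) <;> assumption
    have hadjw : ∀ i j, i < j → j ≤ k → (G.Adj (w i) (w j) ↔ i + 1 = j) := by
      intro i j hij hj
      refine ⟨fun h => ?_, ?_⟩
      · by_contra hcon
        exact hind i j (by omega) hj h
      · rintro rfl
        exact hstep' i (by omega)
    let f : Fin (k + 2) → V := fun t => if (t : ℕ) ≤ k then w t else u
    have hf : Function.Injective f := by
      intro i j hij
      have hi := i.2
      have hj := j.2
      rw [Fin.ext_iff]
      by_contra hne
      simp only [f] at hij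
      split_ifs at hij with h1 h2 h2
      · rcases Nat.lt_or_gt_of_ne hne with h | h
        · exact hinj _ _ h h2 hij
        · exact hinj _ _ h h1 hij.symm
      · exact hwu _ h1 hij
      · exact hwu _ h2 hij.symm
      · omega
    have hfadj : ∀ i j, G.Adj (f i) (f j) ↔ (SimpleGraph.cycleGraph (k + 2)).Adj i j := by
      intro i j
      have hi := i.2
      have hj := j.2
      rw [cycleGraph_adj_iff_val i j (by omega)]
      simp only [f]
      split_ifs with h1 h2 h2
      · rcases lt_trichotomy (i : ℕ) j with h | h | h
        · rw [hadjw _ _ h h2]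
          omega
        · rw [h]
          simp only [SimpleGraph.irrefl, false_iff]
          omega
        · rw [G.adj_comm, hadjw _ _ h h1]
          omega
      · rw [G.adj_comm, hadju _ h1]
        omega
      · rw [hadju _ h2]
        omega
      · simp only [SimpleGraph.irrefl, false_iff]
        omega
    refine hc (k + 2) (by omega) (Set.range f) ⟨(RelIso.symm ⟨Equiv.ofInjective f hf, ?_⟩)⟩
    intro i j
    exact hfadj i j

/-- A cyclic arrangement of `n` vertices (given as an `n`-periodic sequence, `n ≥ 6` even) in which
vertices at positions of different parity are equal or adjacent iff their positions are
consecutive. -/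
structure IsSpecialSeq {V : Type*} (G : SimpleGraph V) (n : ℕ) (c : ℕ → V) : Prop where
  even : n % 2 = 0
  six_le : 6 ≤ n
  periodic : ∀ t, c (t + n) = c t
  near_iff : ∀ i < n, ∀ j < n, i % 2 ≠ j % 2 → (c i = c j ∨ G.Adj (c i) (c j) ↔
    i + 1 = j ∨ j + 1 = i ∨ (i = 0 ∧ j + 1 = n) ∨ (j = 0 ∧ i + 1 = n))

namespace IsSpecialSeq

variable {V : Type*} {G : SimpleGraph V} {n : ℕ} {c : ℕ → V}

lemma shift_one (h : IsSpecialSeq G n c) : IsSpecialSeq G n (fun t => c (t + 1)) where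
  even := h.even
  six_le := h.six_le
  periodic t := by
    rw [show t + n + 1 = t + 1 + n by omega]
    exact h.periodic _
  near_iff i hi j hj hij := by
    have he := h.even
    have h6 := h.six_le
    have hn : c n = c 0 := by simpa using h.periodic 0
    rcases eq_or_lt_of_le (show i + 1 ≤ n from hi) with hi' | hi'
    · rw [hi', hn, h.near_iff 0 (by omega) (j + 1) (by omega) (by omega)]
      omega
    · rcases eq_or_lt_of_le (show j + 1 ≤ n from hj) with hj' | hj'
      · rw [hj', hn, h.near_iff (i + 1) (by omega) 0 (by omega) (by omega)]
        omega
      · rw [h.near_iff (i + 1) hi' (j + 1) hj' (by omega)]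
        omega

lemma shift (h : IsSpecialSeq G n c) (r : ℕ) : IsSpecialSeq G n (fun t => c (t + r)) := by
  induction r with
  | zero => simpa using h
  | succ r ih => simpa [add_assoc, add_comm 1 r] using ih.shift_one

lemma apply_self (h : IsSpecialSeq G n c) : c n = c 0 := by
  simpa using h.periodic 0

lemma apply_mod (h : IsSpecialSeq G n c) (t : ℕ) : c (t % n) = c t := by
  have key : ∀ q s, c (s + n * q) = c s := by
    intro q
    induction q with
    | zero => simp
    | succ q ih =>
      intro s
      rw [Nat.mul_succ, ← add_assoc, h.periodic, ih]
  conv_rhs => rw [← Nat.mod_add_div t n, key]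

lemma mod_parity (h : IsSpecialSeq G n c) (t : ℕ) : t % n % 2 = t % 2 :=
  Nat.mod_mod_of_dvd _ (Nat.dvd_of_mod_eq_zero h.even)

lemma zero_ne_one (h : IsSpecialSeq G n c) (hc : Chordal G) : c 0 ≠ c 1 := by
  intro h01
  have he := h.even
  have h6 := h.six_le
  have near := h.near_iff
  have h2 : c 2 ≠ c 0 := by
    intro h20
    have := (near 0 (by omega) (n - 1) (by omega) (by omega)).2 (by omega)
    rw [← h20] at this
    have := (near 2 (by omega) (n - 1) (by omega) (by omega)).1 this
    omega
  have h3 : c (n - 1) ≠ c 1 := by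
    intro h20
    have := (near 1 (by omega) 2 (by omega) (by omega)).2 (by omega)
    rw [← h20] at this
    have := (near (n - 1) (by omega) 2 (by omega) (by omega)).1 this
    omega
  have hk : 2 + (n - 3) = n - 1 := by omega
  have hfar : ¬ (c 2 = c (n - 1) ∨ G.Adj (c 2) (c (n - 1))) := by
    rw [near 2 (by omega) (n - 1) (by omega) (by omega)]
    omega
  push Not at hfar
  refine hc.not_walk_avoiding (c 0) (n - 3) (fun t => c (2 + t)) ?_ ?_ ?_ ?_ ?_ ?_
  · have := (near 1 (by omega) 2 (by omega) (by omega)).2 (by omega)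
    rw [← h01] at this
    exact this.resolve_left h2.symm
  · simp only [hk]
    refine ((near 0 (by omega) (n - 1) (by omega) (by omega)).2 (by omega)).resolve_left ?_
    rw [h01]
    exact h3.symm
  · simp only [hk]
    exact hfar.1
  · simp only [hk]
    exact hfar.2
  · intro i hi
    exact (near (2 + i) (by omega) (2 + (i + 1)) (by omega) (by omega)).2 (by omega)
  · intro i hi0 hi
    have : ¬ (c 0 = c (2 + i) ∨ G.Adj (c 0) (c (2 + i))) := by
      rcases Nat.mod_two_eq_zero_or_one i with hi2 | hi2
      · rw [h01, near 1 (by omega) (2 + i) (by omega) (by omega)]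
        omega
      · rw [near 0 (by omega) (2 + i) (by omega) (by omega)]
        omega
    push Not at this
    exact ⟨this.1.symm, this.2⟩

lemma adj_succ (h : IsSpecialSeq G n c) (hc : Chordal G) (t : ℕ) : G.Adj (c t) (c (t + 1)) := by
  have h6 := h.six_le
  have hs := h.shift t
  have := ((hs.near_iff 0 (by omega) 1 (by omega) (by omega)).2 (by omega)).resolve_left
    (hs.zero_ne_one hc)
  simpa [add_comm] using this

lemma not_near (h : IsSpecialSeq G n c) {i j : ℕ} (hi : i < n) (hj : j < n)
    (hij : i % 2 ≠ j % 2) (hfar : ¬ (i + 1 = j ∨ j + 1 = i ∨ (i = 0 ∧ j + 1 = n) ∨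
      (j = 0 ∧ i + 1 = n))) : c i ≠ c j ∧ ¬ G.Adj (c i) (c j) := by
  rw [← h.near_iff i hi j hj hij] at hfar
  exact not_or.1 hfar

lemma injOn (h : IsSpecialSeq G n c) (hc : Chordal G) : ∀ i j, i < j → j < n → c i ≠ c j := by
  intro i j hij hj heq
  have he := h.even
  have h6 := h.six_le
  by_cases hp : i % 2 = j % 2
  · have h1 := (h.near_iff i (by omega) (i + 1) (by omega) (by omega)).2 (by omega)
    rw [heq, h.near_iff j hj (i + 1) (by omega) (by omega)] at h1
    have hj2 : j = i + 2 := by omega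
    by_cases hjn : j + 1 < n
    · have h2 := (h.near_iff j hj (j + 1) hjn (by omega)).2 (by omega)
      rw [← heq, h.near_iff i (by omega) (j + 1) hjn (by omega)] at h2
      omega
    · have h2 := (h.near_iff j hj 0 (by omega) (by omega)).2 (by omega)
      rw [← heq, h.near_iff i (by omega) 0 (by omega) (by omega)] at h2
      omega
  · have h1 := (h.near_iff i (by omega) j hj hp).1 (Or.inl heq)
    rcases h1 with h1 | h1 | h1 | h1
    · subst h1
      exact (h.adj_succ hc i).ne heq
    · omega
    · have h2 := h.adj_succ hc j
      rw [h1.2, h.apply_self, ← heq, h1.1] at h2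
      exact h2.ne rfl
    · omega

lemma ne_add (h : IsSpecialSeq G n c) (hc : Chordal G) (i s : ℕ) (hs : 0 < s) (hsn : s < n) :
    c i ≠ c (i + s) := by
  have := (h.shift i).injOn hc 0 s hs hsn
  simpa [add_comm] using this

lemma exists_ear (h : IsSpecialSeq G n c) (hc : Chordal G) : ∃ i, G.Adj (c i) (c (i + 2)) := by
  classical
  have h6 := h.six_le
  have hlast : G.Adj (c 0) (c (0 + (n - 1))) := by
    have := (h.adj_succ hc (n - 1)).symm
    rw [show n - 1 + 1 = n by omega, h.apply_self] at this
    simpa using this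
  have hex : ∃ d, 2 ≤ d ∧ ∃ i, G.Adj (c i) (c (i + d)) := ⟨n - 1, by omega, 0, hlast⟩
  obtain ⟨hd2, i, hi⟩ := Nat.find_spec hex
  have hmin : ∀ d' < Nat.find hex, 2 ≤ d' → ∀ i, ¬ G.Adj (c i) (c (i + d')) :=
    fun d' hd' h2 i hi => Nat.find_min hex hd' ⟨h2, i, hi⟩
  have hdn : Nat.find hex ≤ n - 1 := Nat.find_min' hex ⟨by omega, 0, hlast⟩
  generalize Nat.find hex = d at *
  by_cases hd : d = 2
  · exact ⟨i, hd ▸ hi⟩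
  exfalso
  have hk : i + 1 + (d - 1) = i + d := by omega
  refine hc.not_walk_avoiding (c i) (d - 1) (fun t => c (i + 1 + t)) (h.adj_succ hc i) ?_
    (h.ne_add hc (i + 1) (d - 1) (by omega) (by omega))
    (hmin (d - 1) (by omega) (by omega) (i + 1)) (fun t _ => Or.inr (h.adj_succ hc _)) ?_
  · simpa only [hk] using hi
  · intro t ht0 ht
    rw [add_assoc]
    exact ⟨(h.ne_add hc i (1 + t) (by omega) (by omega)).symm,
      hmin (1 + t) (by omega) (by omega) i⟩

/-- An edge between odd positions and one between even positions cannot be nested. -/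
lemma not_nested (h : IsSpecialSeq G n c) (hc : Chordal G) :
    ∀ N p i j q, i - p + (q - j) = N → p < i → i < j → j < q → q < n → p % 2 = 1 → q % 2 = 1 →
      i % 2 = 0 → j % 2 = 0 → G.Adj (c p) (c q) → G.Adj (c i) (c j) → False := by
  classical
  intro N
  induction N using Nat.strong_induction_on with
  | _ N ih =>
    intro p i j q hN hpi hij hjq hqn hp hq hi hj hpq hij'
    obtain ⟨r, hr, hmax⟩ := ((Finset.Icc (p + 1) i).filter
      (fun r => G.Adj (c p) (c r))).exists_max_image id
      ⟨p + 1, by simp [h.adj_succ hc p]; omega⟩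
    simp only [Finset.mem_filter, Finset.mem_Icc, id] at hr hmax
    have hlast : ¬ (i - r + 1 + (q - j) ≤ i - r) := by omega
    have hlast' : j + (i - r + 1 + (q - j) - (i - r) - 1) = q := by omega
    refine hc.not_walk_avoiding (c p) (i - r + 1 + (q - j))
      (fun t => if t ≤ i - r then c (r + t) else c (j + (t - (i - r) - 1))) ?_ ?_ ?_ ?_ ?_ ?_
    · simpa using hr.2
    · simpa only [if_neg hlast, hlast'] using hpq
    · simp only [if_neg hlast, hlast', Nat.zero_le, if_true, add_zero]
      exact h.injOn hc r q (by omega) hqn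
    · simp only [if_neg hlast, hlast', Nat.zero_le, if_true, add_zero]
      rcases Nat.mod_two_eq_zero_or_one r with hr2 | hr2
      · exact (h.not_near (by omega) hqn (by omega) (by omega)).2
      · intro hrq
        exact ih (i - r + (q - j)) (by omega) r i j q rfl (by omega) hij hjq hqn hr2 hq hi hj
          hrq hij'
    · intro t ht
      right
      rcases lt_trichotomy t (i - r) with h1 | h1 | h1
      · simp only [if_pos h1.le, if_pos (show t + 1 ≤ i - r from h1)]
        exact h.adj_succ hc _
      · have h2 : ¬ t + 1 ≤ i - r := by omega
        have h3 : r + t = i := by omega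
        have h4 : j + (t + 1 - (i - r) - 1) = j := by omega
        simpa only [if_pos h1.le, if_neg h2, h3, h4] using hij'
      · have h2 : ¬ t + 1 ≤ i - r := by omega
        have h4 : j + (t + 1 - (i - r) - 1) = j + (t - (i - r) - 1) + 1 := by omega
        simp only [if_neg (not_le.2 h1), if_neg h2, h4]
        exact h.adj_succ hc _
    · intro t ht0 ht
      split_ifs with h1
      · refine ⟨(h.injOn hc p (r + t) (by omega) (by omega)).symm, fun hadj => ?_⟩
        have := hmax (r + t) ⟨⟨by omega, by omega⟩, hadj⟩
        omega
      · refine ⟨(h.injOn hc p _ (by omega) (by omega)).symm, fun hadj => ?_⟩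
        rcases Nat.mod_two_eq_zero_or_one (j + (t - (i - r) - 1)) with hs | hs
        · exact (h.not_near (by omega) (by omega) (by omega) (by omega)).2 hadj
        · exact ih _ (by omega) p i j (j + (t - (i - r) - 1)) rfl hpi hij (by omega) (by omega)
            hp hs hi hj hadj hij'

lemma not_adj_zero_even (h : IsSpecialSeq G n c) (hc : Chordal G) (h1 : G.Adj (c 1) (c (n - 1)))
    {j : ℕ} (hj0 : 0 < j) (hj : j < n) (hj2 : j % 2 = 0) : ¬ G.Adj (c 0) (c j) := by
  have he := h.even
  have h6 := h.six_le
  intro hadj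
  have hno : ∀ i j, i % 2 = 0 → j % 2 = 0 → 0 < i → i < j → j < n → ¬ G.Adj (c i) (c j) :=
    fun i j hi hj hi0 hij hjn hadj => h.not_nested hc _ 1 i j (n - 1) rfl (by omega) hij
      (by omega) (by omega) (by omega) (by omega) hi hj h1 hadj
  by_cases hjn : j < n - 2
  · have hk : j + 1 + (n - (j + 1)) = n := by omega
    refine hc.not_walk_avoiding (c j) (n - (j + 1)) (fun t => c (j + 1 + t)) (h.adj_succ hc j)
      ?_ ?_ ?_ (fun t _ => Or.inr (h.adj_succ hc _)) ?_
    · simpa only [hk, h.apply_self] using hadj.symm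
    · simp only [hk, h.apply_self, add_zero]
      exact (h.injOn hc 0 (j + 1) (by omega) (by omega)).symm
    · simp only [hk, h.apply_self, add_zero]
      exact (h.not_near (by omega) (by omega) (by omega) (by omega)).2
    · intro t ht0 ht
      refine ⟨(h.injOn hc j _ (by omega) (by omega)).symm, ?_⟩
      rcases Nat.mod_two_eq_zero_or_one (j + 1 + t) with hs | hs
      · exact hno _ _ hj2 hs hj0 (by omega) (by omega)
      · exact (h.not_near (by omega) (by omega) (by omega) (by omega)).2
  · have hprev := (h.adj_succ hc (j - 1)).symm
    rw [show j - 1 + 1 = j by omega] at hprev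
    refine hc.not_walk_avoiding (c j) (j - 1) c hadj.symm hprev
      (h.injOn hc 0 (j - 1) (by omega) (by omega))
      (h.not_near (by omega) (by omega) (by omega) (by omega)).2
      (fun t _ => Or.inr (h.adj_succ hc _)) ?_
    intro t ht0 ht
    refine ⟨h.injOn hc t j (by omega) hj, ?_⟩
    rcases Nat.mod_two_eq_zero_or_one t with hs | hs
    · rw [G.adj_comm]
      exact hno _ _ hs hj2 ht0 (by omega) hj
    · exact (h.not_near (by omega) (by omega) (by omega) (by omega)).2

lemma not_adj_even (h : IsSpecialSeq G n c) (hc : Chordal G) (h1 : G.Adj (c 1) (c (n - 1)))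
    (i j : ℕ) (hi : i % 2 = 0) (hj : j % 2 = 0) : ¬ G.Adj (c i) (c j) := by
  have he := h.even
  have h6 := h.six_le
  have key : ∀ i j, i % 2 = 0 → j % 2 = 0 → i < j → j < n → ¬ G.Adj (c i) (c j) := by
    intro i j hi hj hij hjn
    rcases Nat.eq_zero_or_pos i with rfl | hi0
    · exact h.not_adj_zero_even hc h1 hij hjn hj
    · exact fun hadj => h.not_nested hc _ 1 i j (n - 1) rfl (by omega) hij
        (by omega) (by omega) (by omega) (by omega) hi hj h1 hadj
  rw [← h.apply_mod i, ← h.apply_mod j]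
  have hi' := (h.mod_parity i).trans hi
  have hj' := (h.mod_parity j).trans hj
  have hin := Nat.mod_lt i (show n > 0 by omega)
  have hjn := Nat.mod_lt j (show n > 0 by omega)
  rcases lt_trichotomy (i % n) (j % n) with hlt | heq | hgt
  · exact key _ _ hi' hj' hlt hjn
  · rw [heq]
    exact G.irrefl
  · rw [G.adj_comm]
    exact key _ _ hj' hi' hgt hin

/-- If the even positions are independent, then the two neighbours of an even position are
adjacent. -/
lemma adj_around_even (h : IsSpecialSeq G n c) (hc : Chordal G)
    (hind : ∀ i j, i % 2 = 0 → j % 2 = 0 → ¬ G.Adj (c i) (c j)) (r : ℕ) (hr : r % 2 = 0) :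
    G.Adj (c (1 + r)) (c (n - 1 + r)) := by
  have he := h.even
  have h6 := h.six_le
  have hs := h.shift r
  by_contra hcon
  have hk : 1 + (n - 2) = n - 1 := by omega
  refine hc.not_walk_avoiding (c (0 + r)) (n - 2) (fun t => c (1 + t + r)) ?_ ?_ ?_ ?_ ?_ ?_
  · simpa [add_comm] using hs.adj_succ hc 0
  · have := (hs.adj_succ hc (n - 1)).symm
    rw [show n - 1 + 1 = n by omega, hs.apply_self] at this
    simpa only [hk] using this
  · simpa only [hk] using hs.injOn hc 1 (n - 1) (by omega) (by omega)
  · simpa only [hk] using hcon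
  · intro t _
    right
    have := hs.adj_succ hc (1 + t)
    simpa only [add_assoc] using this
  · intro t ht0 ht
    refine ⟨(hs.injOn hc 0 (1 + t) (by omega) (by omega)).symm, ?_⟩
    rcases Nat.mod_two_eq_zero_or_one (1 + t) with ht2 | ht2
    · exact hind _ _ (by omega) (by omega)
    · exact (hs.not_near (i := 0) (by omega) (by omega) (by omega) (by omega)).2

end IsSpecialSeq

lemma exists_card_eq_alphaS {V : Type*} [Finite V] (G : SimpleGraph V) :
    ∃ T : Finset V, G.SIndepSet ↑T ∧ T.card = alphaS G := by
  have := Fintype.ofFinite V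
  refine Nat.sSup_mem (s := {n | ∃ T : Finset V, G.SIndepSet ↑T ∧ T.card = n})
    ⟨0, ∅, by simp [SimpleGraph.SIndepSet], rfl⟩ ⟨Fintype.card V, ?_⟩
  rintro _ ⟨T, -, rfl⟩
  exact Finset.card_le_univ T

lemma exists_card_eq_thetaS {V : Type*} [Finite V] (G : SimpleGraph V) :
    ∃ D : Finset V, G.DominatingSet D ∧ D.card = thetaS G := by
  have := Fintype.ofFinite V
  exact Nat.sInf_mem (s := {n | ∃ D : Finset V, G.DominatingSet D ∧ D.card = n})
    ⟨_, Finset.univ, fun v => Or.inl (Finset.mem_univ v), rfl⟩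

lemma SimpleGraph.SIndepSet.eq_of_near {V : Type*} {G : SimpleGraph V} {T : Set V}
    (hT : G.SIndepSet T) {u w x : V} (hu : u ∈ T) (hw : w ∈ T) (hxu : x = u ∨ G.Adj x u)
    (hxw : x = w ∨ G.Adj x w) : u = w := by
  by_contra hne
  obtain ⟨h1, h2⟩ := hT u hu w hw hne
  rcases hxu with rfl | hxu
  · exact hxw.elim hne h1
  · rcases hxw with rfl | hxw
    · exact h1 hxu.symm
    · exact h2 x ⟨hxu.symm, hxw⟩

lemma SimpleGraph.DominatingSet.exists_near {V : Type*} {G : SimpleGraph V} {D : Finset V}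
    (hD : G.DominatingSet D) (v : V) : ∃ d ∈ D, d = v ∨ G.Adj d v :=
  (hD v).elim (fun h => ⟨v, h, Or.inl rfl⟩) fun ⟨d, hd, hdv⟩ => ⟨d, hd, Or.inr hdv⟩

lemma SimpleGraph.SIndepSet.card_le_card {V : Type*} {G : SimpleGraph V} {T D : Finset V}
    (hT : G.SIndepSet ↑T) (hD : G.DominatingSet D) : T.card ≤ D.card := by
  choose f hfD hf using hD.exists_near
  exact Finset.card_le_card_of_injOn f (fun v _ => hfD v)
    fun u hu w hw huw => hT.eq_of_near hu hw (hf u) (huw ▸ hf w)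

lemma alphaS_eq_thetaS_of_not_hasOddSpecialCycle {V : Type*} [Fintype V] {G : SimpleGraph V}
    (h : ¬ HasOddSpecialCycle fun x i : V => x = i ∨ G.Adj x i) : alphaS G = thetaS G := by
  obtain ⟨T, -, D, hT, hD, hDT⟩ := exists_packing_cover h (fun i => ⟨i, Or.inl rfl⟩) Finset.univ
  obtain ⟨T', hT', hT'card⟩ := exists_card_eq_alphaS G
  obtain ⟨D', hD', hD'card⟩ := exists_card_eq_thetaS G
  have hTind : G.SIndepSet ↑T := fun u hu w hw hne =>
    ⟨fun huw => hne (hT u u hu w hw (Or.inl rfl) (Or.inr huw)),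
      fun x hx => hne (hT x u hu w hw (Or.inr hx.1.symm) (Or.inr hx.2))⟩
  have hDdom : G.DominatingSet D := by
    intro v
    obtain ⟨x, hx, rfl | hxv⟩ := hD v (Finset.mem_univ v)
    · exact Or.inl hx
    · exact Or.inr ⟨x, hx, hxv⟩
  have h1 := hT'.card_le_card hD'
  have h2 : thetaS G ≤ D.card := Nat.sInf_le ⟨D, hDdom, rfl⟩
  have h3 : T.card ≤ alphaS G := by
    refine le_csSup ⟨Fintype.card V, ?_⟩ ⟨T, hTind, rfl⟩
    rintro _ ⟨T, -, rfl⟩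
    exact Finset.card_le_univ T
  omega

lemma HasOddSpecialCycle.exists_isSpecialSeq {V : Type*} {G : SimpleGraph V}
    (h : HasOddSpecialCycle fun x i : V => x = i ∨ G.Adj x i) :
    ∃ m c, Odd m ∧ IsSpecialSeq G (2 * m) c := by
  obtain ⟨m, a, y, hm, hm3, hay⟩ := h
  beta_reduce at hay
  have hc : ∃ c : ℕ → V, ∀ t, c t =
      if t % (2 * m) % 2 = 0 then a (t % (2 * m) / 2) else y (t % (2 * m) / 2) := ⟨_, fun _ => rfl⟩
  obtain ⟨c, hc⟩ := hc
  refine ⟨m, c, hm, by omega, by omega, fun t => by rw [hc, hc, Nat.add_mod_right], ?_⟩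
  intro i hi j hj hij
  rw [hc i, hc j, Nat.mod_eq_of_lt hi, Nat.mod_eq_of_lt hj]
  rcases Nat.mod_two_eq_zero_or_one i with hi2 | hi2
  · rw [if_pos hi2, if_neg (by omega), eq_comm, G.adj_comm,
      hay (i / 2) (by omega) (j / 2) (by omega)]
    omega
  · rw [if_neg (by omega), if_pos (by omega), hay (j / 2) (by omega) (i / 2) (by omega)]
    omega

namespace IsSpecialSeq

variable {V : Type*} {G : SimpleGraph V} {n : ℕ} {c : ℕ → V}

lemma two_mul_card_le (h : IsSpecialSeq G n c)
    (hadj : ∀ t, G.Adj (c t) (c (t + 1)))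
    (haround : ∀ r, r % 2 = 0 → G.Adj (c (1 + r)) (c (n - 1 + r)))
    (hsurj : ∀ v, ∃ t, c t = v) {T : Finset V} (hT : G.SIndepSet ↑T) : T.card * 2 ≤ n / 2 := by
  classical
  have he := h.even
  have h6 := h.six_le
  have hX : ((Finset.range (n / 2)).image fun k => c (2 * k + 1)).card ≤ n / 2 := by
    simpa using Finset.card_image_le (s := Finset.range (n / 2)) (f := fun k => c (2 * k + 1))
  have hmem : ∀ t, t % 2 = 1 → c t ∈ (Finset.range (n / 2)).image fun k => c (2 * k + 1) := by
    intro t ht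
    have := h.mod_parity t
    have := Nat.mod_lt t (show n > 0 by omega)
    refine Finset.mem_image.2 ⟨t % n / 2, Finset.mem_range.2 (by omega), ?_⟩
    rw [← h.apply_mod t]
    congr 1
    omega
  have hpair : ∀ v, ∃ p q, p % 2 = 1 ∧ q % 2 = 1 ∧ G.Adj (c p) (c q) ∧
      (c p = v ∨ G.Adj (c p) v) ∧ (c q = v ∨ G.Adj (c q) v) := by
    intro v
    obtain ⟨t, rfl⟩ := hsurj v
    rcases Nat.mod_two_eq_zero_or_one t with ht | ht
    · refine ⟨1 + t, n - 1 + t, by omega, by omega, haround t ht, Or.inr ?_, Or.inr ?_⟩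
      · rw [add_comm]
        exact (hadj t).symm
      · have := hadj (n - 1 + t)
        rwa [show n - 1 + t + 1 = t + n by omega, h.periodic] at this
    · have hr := haround (t + 1) (by omega)
      rw [show n - 1 + (t + 1) = t + n by omega, h.periodic] at hr
      exact ⟨1 + (t + 1), t, by omega, by omega, hr, Or.inr hr, Or.inl rfl⟩
  refine (Finset.card_mul_le_card_mul (fun v x => x = v ∨ G.Adj x v) (n := 1) ?_ ?_).trans
    ((mul_one _).le.trans hX)
  · intro v _
    obtain ⟨p, q, hp, hq, hpq, hpv, hqv⟩ := hpair v
    refine (Finset.card_pair hpq.ne).symm.le.trans (Finset.card_le_card ?_)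
    simp only [Finset.insert_subset_iff, Finset.singleton_subset_iff, Finset.mem_bipartiteAbove]
    exact ⟨⟨hmem p hp, hpv⟩, hmem q hq, hqv⟩
  · intro x _
    rw [Finset.card_le_one]
    intro u hu w hw
    rw [Finset.mem_bipartiteBelow] at hu hw
    exact hT.eq_of_near hu.1 hw.1 hu.2 hw.2

lemma le_two_mul_card (h : IsSpecialSeq G n c) (hinj : ∀ i j, i < j → j < n → c i ≠ c j)
    (hind : ∀ i j, i % 2 = 0 → j % 2 = 0 → ¬ G.Adj (c i) (c j))
    (hsurj : ∀ v, ∃ t, c t = v) {D : Finset V} (hD : G.DominatingSet D) :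
    n / 2 ≤ D.card * 2 := by
  classical
  have he := h.even
  have h6 := h.six_le
  have hY : ((Finset.range (n / 2)).image fun k => c (2 * k)).card = n / 2 := by
    rw [Finset.card_image_of_injOn, Finset.card_range]
    intro k hk l hl hkl
    simp only [Finset.coe_range, Set.mem_Iio] at hk hl
    by_contra hne
    rcases Nat.lt_or_gt_of_ne hne with hlt | hlt
    · exact hinj (2 * k) (2 * l) (by omega) (by omega) hkl
    · exact hinj (2 * l) (2 * k) (by omega) (by omega) hkl.symm
  refine hY.symm.le.trans ((mul_one _).symm.le.trans
    (Finset.card_mul_le_card_mul (fun v d => d = v ∨ G.Adj d v) ?_ ?_))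
  · intro v _
    obtain ⟨d, hd, hdv⟩ := hD.exists_near v
    exact Finset.card_pos.2 ⟨d, (Finset.mem_bipartiteAbove _).2 ⟨hd, hdv⟩⟩
  · intro d _
    obtain ⟨t, rfl⟩ := hsurj d
    have hpar := h.mod_parity t
    have htn := Nat.mod_lt t (show n > 0 by omega)
    rw [← h.apply_mod t]
    have hsub : ∃ p q, ∀ k < n / 2, c (t % n) = c (2 * k) ∨ G.Adj (c (t % n)) (c (2 * k)) →
        c (2 * k) = c p ∨ c (2 * k) = c q := by
      rcases Nat.mod_two_eq_zero_or_one t with ht | ht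
      · refine ⟨t % n, t % n, fun k _ hnear => Or.inl (hnear.resolve_right ?_).symm⟩
        exact hind _ _ (by omega) (by omega)
      · refine ⟨t % n - 1, t % n + 1, fun k hk hnear => ?_⟩
        rw [h.near_iff _ htn (2 * k) (by omega) (by omega)] at hnear
        rcases hnear with hk' | hk' | hk' | hk'
        · exact Or.inr (by rw [hk'])
        · exact Or.inl (by rw [← hk', Nat.add_sub_cancel])
        · omega
        · exact Or.inr (by rw [hk'.1, hk'.2, h.apply_self])
    obtain ⟨p, q, hpq⟩ := hsub
    refine (Finset.card_le_card (t := {c p, c q}) ?_).trans Finset.card_le_two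
    intro v hv
    rw [Finset.mem_bipartiteBelow, Finset.mem_image] at hv
    obtain ⟨⟨k, hk, rfl⟩, hkv⟩ := hv
    simpa using hpq k (Finset.mem_range.1 hk) hkv

lemma alphaS_ne_thetaS [Finite V] (h : IsSpecialSeq G n c) (hn : Odd (n / 2))
    (hinj : ∀ i j, i < j → j < n → c i ≠ c j) (hadj : ∀ t, G.Adj (c t) (c (t + 1)))
    (hind : ∀ i j, i % 2 = 0 → j % 2 = 0 → ¬ G.Adj (c i) (c j))
    (haround : ∀ r, r % 2 = 0 → G.Adj (c (1 + r)) (c (n - 1 + r)))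
    (hsurj : ∀ v, ∃ t, c t = v) : alphaS G ≠ thetaS G := by
  obtain ⟨T, hT, hTcard⟩ := exists_card_eq_alphaS G
  obtain ⟨D, hD, hDcard⟩ := exists_card_eq_thetaS G
  have h1 := h.two_mul_card_le hadj haround hsurj hT
  have h2 := h.le_two_mul_card hinj hind hsurj hD
  rw [Nat.odd_iff] at hn
  omega

lemma comap {s : Set V} (h : IsSpecialSeq G n c) (hs : ∀ t, c t ∈ s) :
    IsSpecialSeq (G.induce s) n (fun t => ⟨c t, hs t⟩) where
  even := h.even
  six_le := h.six_le
  periodic t := Subtype.ext (h.periodic t)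
  near_iff i hi j hj hij := by
    simpa only [Subtype.mk.injEq, SimpleGraph.comap_adj, Function.Embedding.subtype_apply]
      using h.near_iff i hi j hj hij

lemma isHamiltonian [Fintype V] [DecidableEq V] (h : IsSpecialSeq G n c)
    (hinj : ∀ i j, i < j → j < n → c i ≠ c j) (hadj : ∀ t, G.Adj (c t) (c (t + 1)))
    (hsurj : ∀ v, ∃ t, c t = v) : G.IsHamiltonian := by
  intro _
  have h6 := h.six_le
  obtain ⟨k, rfl⟩ : ∃ k, n = k + 3 := ⟨n - 3, by omega⟩
  let f : SimpleGraph.cycleGraph (k + 3) →g G :=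
    ⟨fun i => c i, by
      intro i j hij
      rw [cycleGraph_adj_iff_val i j (by omega)] at hij
      rcases hij with hij | hij | ⟨hi, hj⟩ | ⟨hj, hi⟩
      · exact hij ▸ hadj i
      · exact hij ▸ (hadj j).symm
      · have := hadj j
        rw [hj, h.apply_self, ← hi] at this
        exact this.symm
      · have := hadj i
        rwa [hi, h.apply_self, ← hj] at this⟩
  have hf : Function.Bijective f := by
    refine ⟨fun i j hij => ?_, fun v => ?_⟩
    · by_contra hne
      rcases lt_or_gt_of_ne hne with hlt | hlt
      · exact hinj i j hlt j.2 hij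
      · exact hinj j i hlt i.2 hij.symm
    · obtain ⟨t, rfl⟩ := hsurj v
      exact ⟨⟨t % (k + 3), Nat.mod_lt _ (by omega)⟩, h.apply_mod t⟩
  have hcycle : (SimpleGraph.cycleGraph.cycle k).IsHamiltonianCycle :=
    SimpleGraph.Walk.isHamiltonianCycle_iff_isCycle_and_length_eq.2
      ⟨SimpleGraph.cycleGraph.isCycle_cycle, by
        rw [SimpleGraph.cycleGraph.length_cycle, Fintype.card_fin]⟩
  exact ⟨_, _, hcycle.map hf⟩

end IsSpecialSeq

/-- If `G` is a triangulated minimal S-imperfect graph, then `G` is Hamiltonian. -/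
theorem minSImperfect_isHamiltonian {V : Type*} [Fintype V] [DecidableEq V]
    (G : SimpleGraph V) (hc : Chordal G) (h : MinSImperfect G) :
    G.IsHamiltonian := by
  obtain ⟨m, c₀, hm, hc₀⟩ := HasOddSpecialCycle.exists_isSpecialSeq
    (not_imp_comm.1 alphaS_eq_thetaS_of_not_hasOddSpecialCycle h.1)
  obtain ⟨c, hsp, h1⟩ : ∃ c, IsSpecialSeq G (2 * m) c ∧ G.Adj (c 1) (c (2 * m - 1)) := by
    obtain ⟨i, hi⟩ := hc₀.exists_ear hc
    have h6 := hc₀.six_le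
    refine ⟨_, hc₀.shift (i + 1), ?_⟩
    rw [show 2 * m - 1 + (i + 1) = i + 2 * m by omega, hc₀.periodic,
      show 1 + (i + 1) = i + 2 by omega]
    exact hi.symm
  have hinj := hsp.injOn hc
  have hadj := hsp.adj_succ hc
  have hind := hsp.not_adj_even hc h1
  have haround := hsp.adj_around_even hc hind
  by_cases hsurj : ∀ v, ∃ t, c t = v
  · exact hsp.isHamiltonian hinj hadj hsurj
  exfalso
  push Not at hsurj
  obtain ⟨v, hv⟩ := hsurj
  let s : Set ({v}ᶜ : Set V) := {x | ∃ t, c t = x}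
  refine ((hsp.comap (s := {v}ᶜ) hv).comap (s := s) fun t => ⟨t, rfl⟩).alphaS_ne_thetaS ?_ ?_
    hadj hind haround ?_ (h.2 v s)
  · simpa using hm
  · intro i j hij hj heq
    exact hinj i j hij hj (congrArg (fun x => (x.1.1 : V)) heq)
  · rintro ⟨⟨x, hx⟩, t, ht⟩
    exact ⟨t, Subtype.ext (Subtype.ext ht)⟩
end

section
/- A triangulated graph G is S-perfect if and only if G contains no induced subgraph isomorphic to a k-sun with k odd, k ≥ 3. -/
open SimpleGraph

/-- `G` is a *k-sun* (`k ≥ 3`): it has `2k` distinct vertices `v 0, …, v (k-1)`,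
`u 0, …, u (k-1)` (and no others) such that `v 0 v 1 … v (k-1) v 0` is a
(not necessarily induced) cycle, each `u i` is adjacent exactly to `v i` and
`v (i+1)` (indices mod `k`), and each `u i` is simplicial. -/
def IsSun {V : Type*} (G : SimpleGraph V) (k : ℕ) : Prop :=
  ∃ hk : 3 ≤ k,
    haveI : NeZero k := ⟨by omega⟩
    ∃ v u : Fin k → V,
      Function.Injective v ∧ Function.Injective u ∧
      (∀ i j : Fin k, v i ≠ u j) ∧
      (∀ x : V, (∃ i, x = v i) ∨ (∃ i, x = u i)) ∧
      (∀ i : Fin k, G.Adj (v i) (v (i + 1))) ∧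
      (∀ i : Fin k, ∀ x : V, G.Adj (u i) x ↔ (x = v i ∨ x = v (i + 1))) ∧
      (∀ i : Fin k, ∀ x y : V, G.Adj (u i) x → G.Adj (u i) y → x ≠ y → G.Adj x y)

/-- `x` and `y` form a special cycle of length `k` of the relation `Rel`: the submatrix of the
incidence matrix of `Rel` with rows `x i` and columns `y i` (`k`-periodic in `i`) is the
vertex-edge incidence matrix of a cycle of length `k`. -/
def IsSpecialCycle {P I : Type*} (Rel : P → I → Prop) (k : ℕ) (x : ℤ → P) (y : ℤ → I) : Prop :=
  ∀ i j : ℤ, Rel (x i) (y j) ↔ (k : ℤ) ∣ j - i ∨ (k : ℤ) ∣ j - i - 1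

/-- A relation is balanced if it has no special cycle of odd length at least 3. -/
def BalancedRel {P I : Type*} (Rel : P → I → Prop) : Prop :=
  ∀ k : ℕ, Odd k → 3 ≤ k → ∀ (x : ℤ → P) (y : ℤ → I), ¬ IsSpecialCycle Rel k x y

/-- A graph that is not 2-colorable has an odd cycle. -/
lemma SimpleGraph.exists_odd_cycle_of_not_colorable {U : Type*} {G : SimpleGraph U}
    (h : ¬ G.Colorable 2) :
    ∃ (n : ℕ) (c : ℕ → U), Odd n ∧ 3 ≤ n ∧ c n = c 0 ∧ (∀ t < n, G.Adj (c t) (c (t + 1))) ∧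
      ∀ i j, i < j → j < n → c i ≠ c j := by
  classical
  have hex : ∃ n, Odd n ∧ ∃ c : ℕ → U, c n = c 0 ∧ ∀ t < n, G.Adj (c t) (c (t + 1)) := by
    rw [two_colorable_iff_forall_loop_even] at h
    push Not at h
    obtain ⟨u, w, hw⟩ := h
    exact ⟨w.length, by simpa using hw, w.getVert, by simp,
      fun t ht => w.adj_getVert_succ ht⟩
  obtain ⟨hodd, c, hc, hadj⟩ := Nat.find_spec hex
  have hmin : ∀ m < Nat.find hex, ∀ d : ℕ → U, d m = d 0 →
      (∀ t < m, G.Adj (d t) (d (t + 1))) → ¬ Odd m :=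
    fun m hm d h1 h2 h3 => Nat.find_min hex hm ⟨h3, d, h1, h2⟩
  generalize Nat.find hex = n at *
  refine ⟨n, c, hodd, ?_, hc, hadj, fun i j hij hj heq => ?_⟩
  · by_contra hn
    obtain ⟨m, hm⟩ := hodd
    obtain rfl : n = 1 := by omega
    have := hadj 0 (by omega)
    rw [zero_add, hc] at this
    exact G.loopless.irrefl _ this
  · have h1 : ¬ Odd (j - i) := by
      refine hmin (j - i) (by omega) (fun t => c (i + t)) ?_ ?_
      · simp only [add_zero, heq]
        congr 1; omega
      · intro t ht
        exact hadj (i + t) (by omega)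
    have h2 : ¬ Odd (n - (j - i)) := by
      refine hmin (n - (j - i)) (by omega)
        (fun t => if t ≤ i then c t else c (t + (j - i))) ?_ ?_
      · simp only [zero_le, if_true]
        rw [if_neg (by omega), ← hc]
        congr 1; omega
      · intro t ht
        rcases lt_trichotomy t i with h | h | h
        · rw [if_pos h.le, if_pos (by omega)]
          exact hadj t (by omega)
        · subst h
          rw [if_pos le_rfl, if_neg (by omega), heq]
          convert hadj j hj using 2
          omega
        · rw [if_neg (by omega), if_neg (by omega)]
          convert hadj (t + (j - i)) (by omega) using 2
          omega
    rw [Nat.not_odd_iff_even] at h1 h2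
    have := h1.add h2
    rw [show j - i + (n - (j - i)) = n by omega] at this
    exact (Nat.not_even_iff_odd.mpr hodd) this

/-- In a finite graph, some vertex `x` is such that any function which is constant along the edges
avoiding `x` takes the same value at all neighbors of `x`. -/
lemma SimpleGraph.exists_nonseparating_vertex {U : Type*} [Finite U] [Nonempty U]
    (G : SimpleGraph U) :
    ∃ x : U, ∀ {β : Type} (f : U → β),
      (∀ u w, u ≠ x → w ≠ x → G.Adj u w → f u = f w) →
      ∀ u w, G.Adj x u → G.Adj x w → f u = f w := by
  classical
  obtain ⟨r⟩ := ‹Nonempty U›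
  obtain ⟨x, hx, hmax⟩ := Set.exists_max_image {u | G.Reachable r u} (G.dist r)
    (Set.toFinite _) ⟨r, Reachable.refl r⟩
  refine ⟨x, fun {β} f hf => ?_⟩
  have key : ∀ n u, G.Reachable r u → G.dist r u = n → u ≠ x → f u = f r := by
    intro n
    induction n using Nat.strong_induction_on with
    | _ n ih =>
      intro u hu hn hux
      by_cases hur : u = r
      · rw [hur]
      obtain ⟨p, hp⟩ := hu.symm.exists_walk_length_eq_dist
      cases p with
      | nil => exact absurd rfl hur
      | cons hadj q =>
        rename_i w
        have h1 : G.dist w r ≤ q.length := dist_le q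
        simp only [Walk.length_cons] at hp
        rw [dist_comm] at h1 hp
        rw [dist_comm] at hp
        have hwr : G.Reachable r w := q.reachable.symm
        have hu' := hmax u hu
        have hwx : w ≠ x := by
          rintro rfl
          rw [dist_comm] at hp
          omega
        rw [hf u w hux hwx hadj]
        refine ih _ ?_ w hwr rfl hwx
        rw [dist_comm] at hp
        omega
  intro u w hu hw
  have hur : G.Reachable r u := hx.trans hu.reachable
  have hwr : G.Reachable r w := hx.trans hw.reachable
  rw [key _ u hur rfl hu.ne', key _ w hwr rfl hw.ne']

/-- Every finite set of vertices of a balanced hypergraph has a 2-coloring for which every edge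
containing two of these vertices contains vertices of both colors. -/
lemma BalancedRel.exists_bicoloring {P I : Type*} {Rel : P → I → Prop} (hB : BalancedRel Rel)
    (U : Finset I) :
    ∃ f : I → Bool, ∀ p, ∀ i ∈ U, ∀ j ∈ U, i ≠ j → Rel p i → Rel p j →
      ∃ a ∈ U, ∃ b ∈ U, Rel p a ∧ Rel p b ∧ f a ≠ f b := by
  classical
  induction U using Finset.strongInduction with
  | H U ih =>
    rcases U.eq_empty_or_nonempty with rfl | hne
    · exact ⟨fun _ => true, by simp⟩
    let G : SimpleGraph U :=
      { Adj := fun u w => u ≠ w ∧ ∃ p, Rel p u ∧ Rel p w ∧ ∀ z ∈ U, Rel p z → z = u ∨ z = w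
        symm := ⟨fun u w ⟨h, p, hu, hw, hz⟩ =>
          ⟨h.symm, p, hw, hu, fun z hzU hp => (hz z hzU hp).symm⟩⟩
        loopless := ⟨fun u h => h.1 rfl⟩ }
    have hcol : G.Colorable 2 := by
      by_contra hnot
      obtain ⟨n, c, hodd, hn, hc, hadj, hinj⟩ := SimpleGraph.exists_odd_cycle_of_not_colorable hnot
      have hpos : (0 : ℤ) < n := by omega
      have hmod : ∀ i : ℤ, 0 ≤ i % n ∧ i % n < n := fun i =>
        ⟨Int.emod_nonneg _ hpos.ne', Int.emod_lt_of_pos _ hpos⟩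
      let y : ℤ → U := fun i => c (i % n).toNat
      have hy : ∀ i j : ℤ, y j = y i ↔ (n : ℤ) ∣ j - i := by
        intro i j
        rw [Int.dvd_iff_emod_eq_zero, ← Int.emod_eq_emod_iff_emod_sub_eq_zero]
        have h1 := hmod i
        have h2 := hmod j
        refine ⟨fun h => ?_, fun h => by simp only [y, h]⟩
        rcases lt_trichotomy (i % n).toNat (j % n).toNat with hlt | heq | hlt
        · exact absurd h.symm (hinj _ _ hlt (by omega))
        · omega
        · exact absurd h (hinj _ _ hlt (by omega))
      have hyadj : ∀ i, G.Adj (y i) (y (i + 1)) := by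
        intro i
        have h1 := hmod i
        have h2 := hadj (i % n).toNat (by omega)
        convert h2 using 1
        simp only [y]
        rw [← Int.emod_add_emod]
        by_cases hlast : i % n + 1 = n
        · rw [hlast, Int.emod_self, Int.toNat_zero, ← hc]
          congr 1; omega
        · rw [Int.emod_eq_of_lt (by omega) (by omega)]
          congr 1; omega
      choose e he using fun i => (hyadj i).2
      refine hB n hodd hn e (fun i => y i) fun i j => ?_
      rw [← hy, sub_sub, ← hy]
      obtain ⟨h1, h2, h3⟩ := he i
      change Rel (e i) (y j : I) ↔ _
      constructor
      · intro h
        rcases h3 _ (y j).2 h with h | h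
        · exact Or.inl (Subtype.ext h)
        · exact Or.inr (Subtype.ext h)
      · rintro (h | h)
        · rw [h]; exact h1
        · rw [h]; exact h2
    obtain ⟨φ⟩ := hcol
    have : Nonempty U := hne.to_subtype
    obtain ⟨x, hx⟩ := G.exists_nonseparating_vertex
    obtain ⟨ψ, hψ⟩ := ih (U.erase x) (Finset.erase_ssubset x.2)
    have hconst := hx (fun u => (ψ u == decide (φ u = 0))) (by
      intro u w hux hwx huw
      have h1 := φ.valid huw
      obtain ⟨hne', p, hu, hw, hz⟩ := huw
      obtain ⟨a, ha, b, hb, hpa, hpb, hab⟩ := hψ p u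
        (Finset.mem_erase.mpr ⟨fun h => hux (Subtype.ext h), u.2⟩) w
        (Finset.mem_erase.mpr ⟨fun h => hwx (Subtype.ext h), w.2⟩)
        (fun h => hne' (Subtype.ext h)) hu hw
      have h2 : ψ u ≠ ψ w := by
        have ha' := hz a (Finset.mem_of_mem_erase ha) hpa
        have hb' := hz b (Finset.mem_of_mem_erase hb) hpb
        rcases ha' with rfl | rfl <;> rcases hb' with rfl | rfl
        · exact absurd rfl hab
        · exact hab
        · exact hab.symm
        · exact absurd rfl hab
      have h3 : decide (φ u = 0) ≠ decide (φ w = 0) := by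
        generalize φ u = s at *
        generalize φ w = t at *
        revert s t
        decide
      revert h2 h3
      generalize ψ u = s1
      generalize ψ w = s2
      generalize decide (φ u = 0) = s3
      generalize decide (φ w = 0) = s4
      revert s1 s2 s3 s4
      decide)
    have hsame : ∀ u w, G.Adj x u → G.Adj x w → ψ u = ψ w := by
      intro u w hu hw
      have h1 := hconst u w hu hw
      have h2 : φ u = φ w := by
        have ha := φ.valid hu
        have hb := φ.valid hw
        generalize φ u = s at ha ⊢
        generalize φ w = t at hb ⊢
        generalize φ x = r at ha hb
        clear h1
        revert s t r
        decide
      simp only [h2] at h1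
      revert h1
      generalize ψ u = s1
      generalize ψ w = s2
      generalize decide (φ w = 0) = s4
      revert s1 s2 s4
      decide
    obtain ⟨b0, hb0⟩ : ∃ b0 : Bool, ∀ u, G.Adj x u → ψ u ≠ b0 := by
      by_cases hN : ∃ u, G.Adj x u
      · obtain ⟨u, hu⟩ := hN
        exact ⟨!ψ u, fun w hw => by simp [hsame w u hw hu]⟩
      · exact ⟨true, fun u hu => absurd ⟨u, hu⟩ hN⟩
    let f : I → Bool := fun i => if i = x then b0 else ψ i
    have hfx : f x = b0 := if_pos rfl
    have hf : ∀ i : I, i ≠ x → f i = ψ i := fun i hi => if_neg hi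
    refine ⟨f, fun p i hi j hj hij hpi hpj => ?_⟩
    by_cases hcase : ∃ i' ∈ U.erase x, ∃ j' ∈ U.erase x, i' ≠ j' ∧ Rel p i' ∧ Rel p j'
    · obtain ⟨i', hi', j', hj', hij', hpi', hpj'⟩ := hcase
      obtain ⟨a, ha, b, hb, hpa, hpb, hab⟩ := hψ p i' hi' j' hj' hij' hpi' hpj'
      rw [Finset.mem_erase] at ha hb
      exact ⟨a, ha.2, b, hb.2, hpa, hpb, by rwa [hf a ha.1, hf b hb.1]⟩
    · push Not at hcase
      have hout : ∀ u ∈ U, u ≠ x → Rel p u → Rel p x → ∃ a ∈ U, ∃ b ∈ U,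
          Rel p a ∧ Rel p b ∧ f a ≠ f b := by
        intro u hu hux hpu hpx
        refine ⟨u, hu, x, x.2, hpu, hpx, ?_⟩
        rw [hfx, hf u hux]
        refine hb0 ⟨u, hu⟩ ⟨fun h => hux (congrArg Subtype.val h).symm, p, hpx, hpu, ?_⟩
        intro z hz hpz
        by_contra hcon
        push Not at hcon
        exact hcase z (Finset.mem_erase.mpr ⟨hcon.1, hz⟩) u (Finset.mem_erase.mpr ⟨hux, hu⟩)
          hcon.2 hpz hpu
      by_cases hix : i = x
      · subst hix
        exact hout j hj hij.symm hpj hpi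
      · by_cases hjx : j = x
        · subst hjx
          exact hout i hi hij hpi hpj
        · exact absurd hpj (hcase i (Finset.mem_erase.mpr ⟨hix, hi⟩) j
            (Finset.mem_erase.mpr ⟨hjx, hj⟩) hij hpi)

/-- A balanced hypergraph all of whose edges have at most `|C|` elements has a vertex coloring
with color set `C` for which every edge is rainbow. -/
lemma BalancedRel.exists_rainbow_coloring {P I C : Type*} [Fintype P] [Fintype I] [Fintype C]
    [Nonempty C] {Rel : P → I → Prop} (hB : BalancedRel Rel)
    (hdeg : ∀ p, {i | Rel p i}.ncard ≤ Fintype.card C) :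
    ∃ c : I → C, ∀ p i j, Rel p i → Rel p j → c i = c j → i = j := by
  classical
  let E : P → Finset I := fun p => Finset.univ.filter (Rel p)
  have hE : ∀ p i, i ∈ E p ↔ Rel p i := fun p i => by simp [E]
  obtain ⟨c, -, hmax⟩ := Finset.exists_max_image (Finset.univ : Finset (I → C))
    (fun c => ∑ p, ((E p).image c).card) Finset.univ_nonempty
  refine ⟨c, fun p i j hi hj hij => ?_⟩
  by_contra hne
  have hlt : ((E p).image c).card < Fintype.card C := by
    refine lt_of_lt_of_le ?_ (hdeg p)
    rw [Set.ncard_eq_toFinset_card', Set.toFinset_ofPred]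
    refine lt_of_le_of_ne Finset.card_image_le fun h => hne ?_
    exact Finset.card_image_iff.mp h ((hE p i).2 hi) ((hE p j).2 hj) hij
  obtain ⟨b, hb⟩ : ∃ b, b ∉ (E p).image c := by
    by_contra hcon
    push Not at hcon
    rw [Finset.eq_univ_iff_forall.mpr hcon, Finset.card_univ] at hlt
    exact hlt.false
  have hbc : ∀ t, Rel p t → c t ≠ b := fun t ht h =>
    hb (Finset.mem_image.mpr ⟨t, (hE p t).2 ht, h⟩)
  let a := c i
  have hab : a ≠ b := hbc i hi
  let U : Finset I := Finset.univ.filter fun t => c t = a ∨ c t = b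
  have hU : ∀ t, t ∈ U ↔ c t = a ∨ c t = b := fun t => by simp [U]
  obtain ⟨f, hf⟩ := hB.exists_bicoloring U
  let c' : I → C := fun t => if t ∈ U then (if f t then a else b) else c t
  have hc'U : ∀ t ∈ U, c' t = if f t then a else b := fun t ht => if_pos ht
  have hc'n : ∀ t, t ∉ U → c' t = c t := fun t ht => if_neg ht
  have hsplit : ∀ (d : I → C), (∀ t, t ∉ U → d t = c t) → (∀ t ∈ U, d t = a ∨ d t = b) → ∀ q,
      ((E q).image d).card = ((E q \ U).image c).card + ((E q ∩ U).image d).card := by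
    intro d hd hdU q
    have h1 : (E q \ U).image c = (E q \ U).image d :=
      Finset.image_congr fun t ht => (hd t (Finset.mem_sdiff.mp ht).2).symm
    rw [h1, ← Finset.card_union_of_disjoint, ← Finset.image_union, Finset.sdiff_union_inter]
    rw [Finset.disjoint_left]
    intro z hz hz'
    obtain ⟨t, ht, rfl⟩ := Finset.mem_image.mp hz
    obtain ⟨s, hs, hst⟩ := Finset.mem_image.mp hz'
    have htU := (Finset.mem_sdiff.mp ht).2
    rw [hd t htU] at hst
    refine htU ((hU t).2 ?_)
    rw [← hst]
    exact hdU s (Finset.mem_inter.mp hs).2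
  have hcab : ∀ t ∈ U, c t = a ∨ c t = b := fun t ht => (hU t).1 ht
  have hc'ab : ∀ t ∈ U, c' t = a ∨ c' t = b := by
    intro t ht
    rw [hc'U t ht]
    split_ifs
    · exact Or.inl rfl
    · exact Or.inr rfl
  have htwo : ∀ q, ∀ s ∈ U, ∀ t ∈ U, s ≠ t → Rel q s → Rel q t →
      2 ≤ ((E q ∩ U).image c').card := by
    intro q s hs t ht hst hqs hqt
    obtain ⟨s', hs', t', ht', hqs', hqt', hne'⟩ := hf q s hs t ht hst hqs hqt
    refine Finset.one_lt_card.mpr ⟨c' s', Finset.mem_image_of_mem _ ?_, c' t',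
      Finset.mem_image_of_mem _ ?_, ?_⟩
    · exact Finset.mem_inter.mpr ⟨(hE _ _).2 hqs', hs'⟩
    · exact Finset.mem_inter.mpr ⟨(hE _ _).2 hqt', ht'⟩
    · rw [hc'U _ hs', hc'U _ ht']
      revert hne'
      cases f s' <;> cases f t' <;> simp [hab, hab.symm]
  have hle : ∀ q, ((E q).image c).card ≤ ((E q).image c').card := by
    intro q
    rw [hsplit c (fun _ _ => rfl) hcab, hsplit c' hc'n hc'ab]
    refine Nat.add_le_add_left ?_ _
    by_cases hcase : ∃ s ∈ U, ∃ t ∈ U, s ≠ t ∧ Rel q s ∧ Rel q t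
    · obtain ⟨s, hs, t, ht, hst, hqs, hqt⟩ := hcase
      refine le_trans ?_ (htwo q s hs t ht hst hqs hqt)
      refine (Finset.card_le_card (t := {a, b}) ?_).trans Finset.card_le_two
      intro z hz
      obtain ⟨t, ht, rfl⟩ := Finset.mem_image.mp hz
      simpa using hcab t (Finset.mem_inter.mp ht).2
    · refine Finset.card_image_le.trans_eq (Finset.card_image_of_injOn ?_).symm
      intro s hs t ht _
      by_contra hst
      simp only [Finset.coe_inter, Set.mem_inter_iff, Finset.mem_coe, hE] at hs ht
      exact hcase ⟨s, hs.2, t, ht.2, hst, hs.1, ht.1⟩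
  have hstrict : ((E p).image c).card < ((E p).image c').card := by
    rw [hsplit c (fun _ _ => rfl) hcab, hsplit c' hc'n hc'ab]
    refine Nat.add_lt_add_left ?_ _
    have h2 := htwo p i ((hU i).2 (Or.inl rfl)) j ((hU j).2 (Or.inl hij.symm)) hne hi hj
    refine lt_of_le_of_lt ?_ h2
    rw [Finset.card_le_one]
    have h3 : ∀ z ∈ (E p ∩ U).image c, z = a := by
      intro z hz
      obtain ⟨t, ht, rfl⟩ := Finset.mem_image.mp hz
      rw [Finset.mem_inter, hE] at ht
      exact (hcab t ht.2).resolve_right (hbc t ht.1)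
    intro z hz w hw
    rw [h3 z hz, h3 w hw]
  exact absurd (hmax c' (Finset.mem_univ _))
    (not_le.mpr (Finset.sum_lt_sum (fun q _ => hle q) ⟨p, Finset.mem_univ _, hstrict⟩))

/-- `M` is a matching for `Rel`: no `p` is incident with two members of `M`. -/
def IsRelMatching {P I : Type*} (Rel : P → I → Prop) (M : Finset I) : Prop :=
  ∀ p, ∀ i ∈ M, ∀ j ∈ M, Rel p i → Rel p j → i = j

/-- In a balanced hypergraph, some vertex lies on every maximum matching. -/
lemma BalancedRel.exists_vertex_meeting_maximum_matchings {P I : Type*} [Fintype P] [Nonempty P]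
    {Rel : P → I → Prop} (hB : BalancedRel Rel) (hne : ∀ i, ∃ p, Rel p i)
    (J : Finset I) (n : ℕ) (hn : 0 < n)
    (hmax : ∀ M ⊆ J, IsRelMatching Rel M → M.card ≤ n) :
    ∃ p, ∀ M ⊆ J, IsRelMatching Rel M → M.card = n → ∃ i ∈ M, Rel p i := by
  classical
  by_contra hcon
  push Not at hcon
  choose M hMJ hM hMn hMp using hcon
  obtain ⟨p₀⟩ := ‹Nonempty P›
  obtain ⟨i₀, hi₀⟩ : (M p₀).Nonempty := by rw [← Finset.card_pos, hMn]; exact hn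
  obtain ⟨q₀, hq₀⟩ := hne i₀
  have hqp : q₀ ≠ p₀ := by
    rintro rfl
    exact hMp _ _ hi₀ hq₀
  let C := {p : P // p ≠ p₀}
  have : Nonempty C := ⟨⟨q₀, hqp⟩⟩
  have hC : Fintype.card C = Fintype.card P - 1 := by
    simp [C, Fintype.card_subtype_compl]
  have hcardP : 0 < Fintype.card P := Fintype.card_pos_iff.mpr ⟨p₀⟩
  let I' := Σ p, M p
  let Rel' : P → I' → Prop := fun q t => Rel q t.2
  have hB' : BalancedRel Rel' := fun k hk hk3 x y h =>
    hB k hk hk3 x (fun j => ((y j).2 : I)) h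
  obtain ⟨c, hc⟩ := hB'.exists_rainbow_coloring (C := C) (by
    intro q
    rw [hC, Set.ncard_eq_toFinset_card', ← Finset.card_univ (α := P),
      ← Finset.card_erase_of_mem (Finset.mem_univ q)]
    refine Finset.card_le_card_of_injOn Sigma.fst ?_ ?_
    · rintro ⟨p, i⟩ ht
      simp only [Set.coe_toFinset, Set.mem_ofPred_eq, Rel'] at ht
      simp only [Finset.coe_erase, Finset.coe_univ, Set.mem_sdiff, Set.mem_univ, true_and,
        Set.mem_singleton_iff]
      rintro rfl
      exact hMp _ _ i.2 ht
    · rintro ⟨p, i⟩ hi ⟨p', j⟩ hj hpp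
      simp only [Set.coe_toFinset, Set.mem_ofPred_eq, Rel'] at hi hj
      dsimp only at hpp
      subst hpp
      rw [Subtype.ext (hM p q i i.2 j j.2 hi hj)])
  have hI' : Fintype.card I' = Fintype.card P * n := by
    simp [I', hMn]
  obtain ⟨a, -, ha⟩ := Finset.exists_lt_card_fiber_of_mul_lt_card_of_maps_to (n := n)
    (s := (Finset.univ : Finset I')) (t := (Finset.univ : Finset C)) (f := c) (by simp) (by
      rw [Finset.card_univ, Finset.card_univ, hI', hC]
      exact Nat.mul_lt_mul_of_pos_right (by omega) hn)
  refine absurd (hmax ((Finset.univ.filter fun t => c t = a).image fun t => (t.2 : I)) ?_ ?_) ?_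
  · intro z hz
    obtain ⟨t, -, rfl⟩ := Finset.mem_image.mp hz
    exact hMJ _ t.2.2
  · intro p i hi j hj hpi hpj
    obtain ⟨t, ht, rfl⟩ := Finset.mem_image.mp hi
    obtain ⟨s, hs, rfl⟩ := Finset.mem_image.mp hj
    rw [Finset.mem_filter] at ht hs
    rw [hc p t s hpi hpj (ht.2.trans hs.2.symm)]
  · rw [not_le, Finset.card_image_of_injOn]
    · exact ha
    · intro t ht s hs hts
      simp only [Finset.coe_filter, Finset.mem_univ, true_and, Set.mem_ofPred_eq] at ht hs hts
      obtain ⟨p, hp⟩ := hne t.2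
      exact hc p t s hp (by rw [hts] at hp; exact hp) (ht.trans hs.symm)

/-- König property of balanced hypergraphs. -/
lemma BalancedRel.exists_transversal_card_le_matching {P I : Type*} [Fintype P]
    {Rel : P → I → Prop} (hB : BalancedRel Rel) (hne : ∀ i, ∃ p, Rel p i) (J : Finset I) :
    ∃ M ⊆ J, ∃ D : Finset P, IsRelMatching Rel M ∧ (∀ i ∈ J, ∃ p ∈ D, Rel p i) ∧
      D.card ≤ M.card := by
  classical
  induction J using Finset.strongInduction with
  | H J ih =>
    rcases J.eq_empty_or_nonempty with rfl | ⟨j, hj⟩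
    · exact ⟨∅, subset_rfl, ∅, by simp [IsRelMatching], by simp, le_rfl⟩
    obtain ⟨M, hM, hmax⟩ := Finset.exists_max_image (J.powerset.filter (IsRelMatching Rel))
      Finset.card ⟨∅, by simp [IsRelMatching]⟩
    simp only [Finset.mem_filter, Finset.mem_powerset] at hM hmax
    have hpos : 0 < M.card := by
      have := hmax {j} ⟨by simpa using hj, by
        intro p a ha b hb _ _
        rw [Finset.mem_singleton] at ha hb
        rw [ha, hb]⟩
      rw [Finset.card_singleton] at this
      omega
    have : Nonempty P := ⟨(hne j).choose⟩
    obtain ⟨p, hp⟩ := hB.exists_vertex_meeting_maximum_matchings hne J M.card hpos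
      fun N hN hN' => hmax N ⟨hN, hN'⟩
    have hsub : J.filter (fun i => ¬ Rel p i) ⊂ J := by
      rw [Finset.filter_ssubset]
      obtain ⟨i, hi, hpi⟩ := hp M hM.1 hM.2 rfl
      exact ⟨i, hM.1 hi, not_not.mpr hpi⟩
    obtain ⟨N, hN, D, hNm, hD, hDN⟩ := ih _ hsub
    have hNJ : N ⊆ J := hN.trans (Finset.filter_subset _ _)
    have hlt : N.card < M.card := by
      refine lt_of_le_of_ne (hmax N ⟨hNJ, hNm⟩) fun h => ?_
      obtain ⟨i, hi, hpi⟩ := hp N hNJ hNm h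
      exact (Finset.mem_filter.mp (hN hi)).2 hpi
    refine ⟨M, hM.1, insert p D, hM.2, fun i hi => ?_, ?_⟩
    · by_cases hpi : Rel p i
      · exact ⟨p, Finset.mem_insert_self _ _, hpi⟩
      · obtain ⟨q, hq, hqi⟩ := hD i (Finset.mem_filter.mpr ⟨hi, hpi⟩)
        exact ⟨q, Finset.mem_insert_of_mem hq, hqi⟩
    · exact (Finset.card_insert_le _ _).trans (by omega)

/-- The relation of being equal or adjacent, i.e. of lying in the closed neighborhood. -/
def SimpleGraph.ClosedAdj {V : Type*} (G : SimpleGraph V) (u v : V) : Prop :=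
  u = v ∨ G.Adj u v

namespace SimpleGraph.ClosedAdj

variable {V : Type*} {G : SimpleGraph V} {u v : V}

protected lemma refl (u : V) : G.ClosedAdj u u := Or.inl rfl

protected lemma symm (h : G.ClosedAdj u v) : G.ClosedAdj v u :=
  h.imp Eq.symm fun h => h.symm

lemma comm : G.ClosedAdj u v ↔ G.ClosedAdj v u := ⟨fun h => h.symm, fun h => h.symm⟩

lemma adj_of_ne (h : G.ClosedAdj u v) (hne : u ≠ v) : G.Adj u v := h.resolve_left hne

end SimpleGraph.ClosedAdj

lemma SimpleGraph.sIndepSet_iff_isRelMatching {V : Type*} {G : SimpleGraph V} {T : Finset V} :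
    G.SIndepSet ↑T ↔ IsRelMatching G.ClosedAdj T := by
  constructor
  · intro h p i hi j hj hpi hpj
    by_contra hij
    obtain ⟨h1, h2⟩ := h i hi j hj hij
    rcases hpi with rfl | hpi <;> rcases hpj with rfl | hpj
    · exact hij rfl
    · exact h1 hpj
    · exact h1 hpi.symm
    · exact h2 p ⟨hpi.symm, hpj⟩
  · intro h u hu w hw huw
    exact ⟨fun hadj => huw (h u u hu w hw (.refl u) (Or.inr hadj)),
      fun x hx => huw (h x u hu w hw (Or.inr hx.1.symm) (Or.inr hx.2))⟩

lemma SimpleGraph.dominatingSet_iff {V : Type*} {G : SimpleGraph V} {D : Finset V} :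
    G.DominatingSet D ↔ ∀ v, ∃ d ∈ D, G.ClosedAdj d v := by
  refine forall_congr' fun v => ⟨?_, ?_⟩
  · rintro (h | ⟨d, hd, h⟩)
    · exact ⟨v, h, .refl v⟩
    · exact ⟨d, hd, Or.inr h⟩
  · rintro ⟨d, hd, rfl | h⟩
    · exact Or.inl hd
    · exact Or.inr ⟨d, hd, h⟩

section Finite

variable {V : Type*} [Fintype V] (G : SimpleGraph V)

lemma bddAbove_card_sIndepSet : BddAbove {n | ∃ T : Finset V, G.SIndepSet ↑T ∧ T.card = n} := by
  refine ⟨Fintype.card V, ?_⟩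
  rintro _ ⟨T, -, rfl⟩
  exact T.card_le_univ

lemma exists_sIndepSet_card_eq_alphaS : ∃ T : Finset V, G.SIndepSet ↑T ∧ T.card = alphaS G :=
  Nat.sSup_mem (s := {n | ∃ T : Finset V, G.SIndepSet ↑T ∧ T.card = n})
    ⟨0, ∅, by simp [SimpleGraph.SIndepSet], rfl⟩ (bddAbove_card_sIndepSet G)

lemma exists_dominatingSet_card_eq_thetaS :
    ∃ D : Finset V, G.DominatingSet D ∧ D.card = thetaS G :=
  Nat.sInf_mem (s := {n | ∃ D : Finset V, G.DominatingSet D ∧ D.card = n})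
    ⟨_, Finset.univ, fun v => Or.inl (Finset.mem_univ v), rfl⟩

lemma alphaS_le_thetaS : alphaS G ≤ thetaS G := by
  obtain ⟨T, hT, hT'⟩ := exists_sIndepSet_card_eq_alphaS G
  obtain ⟨D, hD, hD'⟩ := exists_dominatingSet_card_eq_thetaS G
  rw [sIndepSet_iff_isRelMatching] at hT
  rw [dominatingSet_iff] at hD
  choose f hf hfa using hD
  rw [← hT', ← hD']
  refine Finset.card_le_card_of_injOn f (fun v _ => hf v) fun u hu w hw huw => ?_
  exact hT (f u) u hu w hw (hfa u) (huw ▸ hfa w)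

variable {G}

lemma alphaS_eq_thetaS_of_balanced (hB : BalancedRel G.ClosedAdj) : alphaS G = thetaS G := by
  obtain ⟨M, -, D, hM, hD, hDM⟩ := hB.exists_transversal_card_le_matching
    (fun v => ⟨v, .refl v⟩) Finset.univ
  refine le_antisymm (alphaS_le_thetaS G) ?_
  have h1 : thetaS G ≤ D.card :=
    Nat.sInf_le ⟨D, dominatingSet_iff.mpr fun v => hD v (Finset.mem_univ v), rfl⟩
  have h2 : M.card ≤ alphaS G :=
    le_csSup (bddAbove_card_sIndepSet G) ⟨M, sIndepSet_iff_isRelMatching.mpr hM, rfl⟩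
  exact h1.trans (hDM.trans h2)

end Finite

/-- An odd sun has no S-independent set as large as a dominating set. -/
lemma IsSun.alphaS_ne_thetaS {V : Type*} [Fintype V] {G : SimpleGraph V} {k : ℕ} (hk : Odd k)
    (h : IsSun G k) : alphaS G ≠ thetaS G := by
  classical
  obtain ⟨hk3, v, u, hv, hu, hvu, hcover, hcyc, hadj, -⟩ := h
  have : NeZero k := ⟨by omega⟩
  have : Fact (1 < k) := ⟨by omega⟩
  have hne : ∀ i : Fin k, i + 1 ≠ i := by
    intro i h
    have h0 : (1 : Fin k) = 0 := by simpa using h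
    simp [Fin.ext_iff, Fin.coe_ofNat_eq_mod, Nat.mod_eq_of_lt (show 1 < k by omega)] at h0
  obtain ⟨T, hT, hT'⟩ := exists_sIndepSet_card_eq_alphaS G
  obtain ⟨D, hD, hD'⟩ := exists_dominatingSet_card_eq_thetaS G
  rw [sIndepSet_iff_isRelMatching] at hT
  rw [dominatingSet_iff] at hD
  have h1 : T.card * 2 ≤ k := by
    let f : V → Finset (Fin k) := fun t => Finset.univ.filter fun i => G.ClosedAdj (v i) t
    have hdisj : (T : Set V).PairwiseDisjoint f := by
      intro s hs t ht hst
      rw [Function.onFun, Finset.disjoint_left]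
      intro i hi hi'
      simp only [f, Finset.mem_filter, Finset.mem_univ, true_and] at hi hi'
      exact hst (hT _ s hs t ht hi hi')
    have hcard : ∀ t ∈ T, 2 ≤ (f t).card := by
      intro t _
      refine Finset.one_lt_card.mpr ?_
      simp only [f, Finset.mem_filter, Finset.mem_univ, true_and]
      rcases hcover t with ⟨i, rfl⟩ | ⟨i, rfl⟩
      · exact ⟨i, .refl _, i + 1, Or.inr (hcyc i).symm, (hne i).symm⟩
      · exact ⟨i, Or.inr ((hadj i _).2 (Or.inl rfl)).symm, i + 1,
          Or.inr ((hadj i _).2 (Or.inr rfl)).symm, (hne i).symm⟩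
    calc T.card * 2 ≤ ∑ t ∈ T, (f t).card := by
          simpa using Finset.card_nsmul_le_sum T (fun t => (f t).card) 2 hcard
      _ = (T.biUnion f).card := (Finset.card_biUnion hdisj).symm
      _ ≤ k := by simpa using Finset.card_le_univ (T.biUnion f)
  have h2 : k ≤ D.card * 2 := by
    let g : V → Finset (Fin k) := fun d => Finset.univ.filter fun i => G.ClosedAdj d (u i)
    have hcard : ∀ d ∈ D, (g d).card ≤ 2 := by
      intro d _
      rcases hcover d with ⟨j, rfl⟩ | ⟨j, rfl⟩
      · refine (Finset.card_le_card (t := {j, j - 1}) fun i hi => ?_).trans Finset.card_le_two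
        simp only [g, Finset.mem_filter, Finset.mem_univ, true_and] at hi
        rcases (hadj i _).1 (hi.adj_of_ne (hvu j i)).symm with h | h
        · simp [hv h]
        · simp [hv h]
      · refine (Finset.card_le_card (t := {j}) fun i hi => ?_).trans (by simp)
        simp only [g, Finset.mem_filter, Finset.mem_univ, true_and] at hi
        rcases hi with h | h
        · simp [hu h]
        · rcases (hadj j _).1 h with h | h
          · exact absurd h.symm (hvu _ _)
          · exact absurd h.symm (hvu _ _)
    calc k = (D.biUnion g).card := by
          suffices huniv : D.biUnion g = Finset.univ by
            rw [huniv, Finset.card_univ, Fintype.card_fin]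
          refine Finset.eq_univ_iff_forall.mpr fun i => ?_
          obtain ⟨d, hd, hdi⟩ := hD (u i)
          exact Finset.mem_biUnion.mpr ⟨d, hd, by simpa [g] using hdi⟩
      _ ≤ D.card * 2 := Finset.card_biUnion_le_card_mul D g 2 hcard
  obtain ⟨m, hm⟩ := hk
  omega

/-- In a chordal graph, an edge of a closed walk of length at least 3 lies in a triangle with a
vertex of the rest of the walk. -/
lemma Chordal.exists_closedAdj_of_sequence {V : Type*} {G : SimpleGraph V} (hG : Chordal G)
    {W : Set V} (n : ℕ) (c : ℕ → V) (hn : 2 ≤ n) (hW : ∀ t, 0 < t → t < n → c t ∈ W)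
    (hstep : ∀ t < n, G.ClosedAdj (c t) (c (t + 1))) (hends : G.ClosedAdj (c 0) (c n)) :
    ∃ w ∈ W, G.ClosedAdj (c 0) w ∧ G.ClosedAdj w (c n) := by
  induction n using Nat.strong_induction_on generalizing c with
  | _ n ih =>
    obtain rfl | hn3 := hn.eq_or_lt
    · exact ⟨c 1, hW 1 (by omega) (by omega), hstep 0 (by omega), hstep 1 (by omega)⟩
    rcases hends with heq | hadj
    · exact ⟨c 1, hW 1 (by omega) (by omega), hstep 0 (by omega),
        heq ▸ (hstep 0 (by omega)).symm⟩
    by_cases hchord : ∃ i j, i + 2 ≤ j ∧ j ≤ n ∧ (0 < i ∨ j < n) ∧ G.ClosedAdj (c i) (c j)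
    · obtain ⟨i, j, hij, hj, hij', h⟩ := hchord
      obtain ⟨d, hd⟩ : ∃ d, j = i + 1 + d := ⟨j - (i + 1), by omega⟩
      let c' : ℕ → V := fun t => if t ≤ i then c t else c (t + d)
      have hle : ∀ t, t ≤ i → c' t = c t := fun t ht => if_pos ht
      have hgt : ∀ t, i < t → c' t = c (t + d) := fun t ht => if_neg (by omega)
      have h0 : c' 0 = c 0 := hle 0 (by omega)
      have hlast : c' (n - d) = c n := by
        rw [hgt _ (by omega)]
        congr 1; omega
      obtain ⟨w, hw, h1, h2⟩ := ih (n - d) (by omega) c' (by omega)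
        (fun t ht ht' => by
          rcases le_or_gt t i with hti | hti
          · rw [hle t hti]; exact hW t ht (by omega)
          · rw [hgt t hti]; exact hW _ (by omega) (by omega))
        (fun t ht => by
          rcases lt_trichotomy t i with hti | hti | hti
          · rw [hle t hti.le, hle (t + 1) (by omega)]
            exact hstep t (by omega)
          · rw [hle t hti.le, hgt (t + 1) (by omega), hti, ← hd]
            exact h
          · rw [hgt t hti, hgt (t + 1) (by omega), add_right_comm]
            exact hstep _ (by omega))
        (by rw [h0, hlast]; exact Or.inr hadj)
      exact ⟨w, hw, h0 ▸ h1, hlast ▸ h2⟩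
    · exfalso
      push Not at hchord
      have hsucc : ∀ t < n, c t ≠ c (t + 1) := by
        intro t ht h
        by_cases htn : t + 2 ≤ n
        · exact hchord t (t + 2) le_rfl htn (by omega) (h ▸ hstep (t + 1) (by omega))
        · refine hchord (t - 1) (t + 1) (by omega) (by omega) (by omega) (h ▸ ?_)
          have := hstep (t - 1) (by omega)
          rwa [show t - 1 + 1 = t by omega] at this
      have hne : ∀ i j, i < j → j ≤ n → c i ≠ c j := by
        intro i j hij hj h
        rcases Nat.lt_or_ge j (i + 2) with h1 | h1
        · obtain rfl : j = i + 1 := by omega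
          exact hsucc i (by omega) h
        · by_cases h2 : 0 < i ∨ j < n
          · exact hchord i j h1 hj h2 (Or.inl h)
          · obtain ⟨rfl, rfl⟩ : i = 0 ∧ j = n := by omega
            exact hadj.ne h
      have hadj_iff : ∀ i j, i < j → j ≤ n → (G.Adj (c i) (c j) ↔ j = i + 1 ∨ i = 0 ∧ j = n) := by
        intro i j hij hj
        constructor
        · intro h
          by_contra hcon
          exact hchord i j (by omega) hj (by omega) (Or.inr h)
        · rintro (rfl | ⟨rfl, rfl⟩)
          · exact (hstep i (by omega)).adj_of_ne (hsucc i (by omega))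
          · exact hadj
      let f : Fin (n + 1) → V := fun i => c i
      have hf : Function.Injective f := by
        intro i j hij
        by_contra hne'
        rcases lt_or_gt_of_ne hne' with h | h
        · exact hne i j h (by omega) hij
        · exact hne j i h (by omega) hij.symm
      have hcyc : ∀ i j : Fin (n + 1), i < j →
          ((cycleGraph (n + 1)).Adj i j ↔ (j : ℕ) = i + 1 ∨ (i : ℕ) = 0 ∧ (j : ℕ) = n) := by
        intro i j hij
        have hi := i.2
        have hj := j.2
        have hij' : (i : ℕ) < j := hij
        rw [cycleGraph_adj', Fin.sub_val_of_le hij.le, Fin.val_sub, Nat.mod_eq_of_lt (by omega)]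
        omega
      have hiff : ∀ i j : Fin (n + 1), G.Adj (f i) (f j) ↔ (cycleGraph (n + 1)).Adj i j := by
        intro i j
        rcases lt_trichotomy i j with h | h | h
        · rw [hcyc i j h]
          exact hadj_iff i j h (by omega)
        · subst h
          simp
        · rw [G.adj_comm, (cycleGraph (n + 1)).adj_comm, hcyc j i h]
          exact hadj_iff j i h (by omega)
      exact hG (n + 1) (by omega) (Set.range f)
        ⟨(⟨Equiv.ofInjective f hf, fun {i j} => hiff i j⟩ :
          cycleGraph (n + 1) ≃g G.induce (Set.range f)).symm⟩

/-- In a chordal graph, if `a` and `b` are adjacent and joined by a walk with interior in `W`, then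
some element of `W` is adjacent to both. -/
lemma Chordal.exists_closedAdj {V : Type*} {G : SimpleGraph V} (hG : Chordal G)
    {W : Set V} {a b p q : V} (hab : G.ClosedAdj a b) (hp : p ∈ W) (hap : G.ClosedAdj a p)
    (hpq : Relation.ReflTransGen (fun u v => G.ClosedAdj u v ∧ v ∈ W) p q)
    (hqb : G.ClosedAdj q b) :
    ∃ w ∈ W, G.ClosedAdj a w ∧ G.ClosedAdj w b := by
  obtain ⟨n, c, h0, hcq, hcW, hstep⟩ : ∃ (n : ℕ) (c : ℕ → V), c 0 = a ∧ c (n + 1) = q ∧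
      (∀ t, 0 < t → t ≤ n + 1 → c t ∈ W) ∧ ∀ t ≤ n, G.ClosedAdj (c t) (c (t + 1)) := by
    clear hqb
    induction hpq with
    | refl =>
      refine ⟨0, fun t => if t = 0 then a else p, by simp, by simp, fun t ht _ => ?_,
        fun t ht => ?_⟩
      · simpa [ht.ne'] using hp
      · obtain rfl : t = 0 := by omega
        simpa using hap
    | @tail r s _ hrs ih =>
      obtain ⟨n, c, h0, hcq, hcW, hstep⟩ := ih
      refine ⟨n + 1, fun t => if t ≤ n + 1 then c t else s, by simpa using h0, by simp,
        fun t ht ht' => ?_, fun t ht => ?_⟩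
      · dsimp only
        split_ifs with h
        · exact hcW t ht h
        · exact hrs.2
      · dsimp only
        rcases ht.lt_or_eq with h | rfl
        · rw [if_pos (by omega), if_pos (by omega)]
          exact hstep t (by omega)
        · rw [if_pos le_rfl, if_neg (by omega), hcq]
          exact hrs.1
  have := hG.exists_closedAdj_of_sequence (W := W) (n + 2) (fun t => if t ≤ n + 1 then c t else b)
    (by omega) (fun t ht ht' => by
      rw [if_pos (by omega)]
      exact hcW t ht (by omega))
    (fun t ht => by
      rcases (show t ≤ n + 1 by omega).lt_or_eq with h | rfl
      · rw [if_pos (by omega), if_pos (by omega)]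
        exact hstep t (by omega)
      · rw [if_pos le_rfl, if_neg (by omega), hcq]
        exact hqb)
    (by simpa [h0] using hab)
  simpa [h0] using this

lemma Int.eq_zero_or_eq_of_dvd {k d : ℤ} (h : k ∣ d) (h1 : -k < d) (h2 : d < 2 * k) :
    d = 0 ∨ d = k := by
  obtain ⟨m, rfl⟩ := h
  have hk : 0 < k := by omega
  have hm1 : -1 < m := by nlinarith
  have hm2 : m < 2 := by nlinarith
  obtain rfl | rfl : m = 0 ∨ m = 1 := by omega
  · simp
  · simp

section SpecialCycle

variable {V : Type*} {G : SimpleGraph V} {k : ℕ} {x y : ℤ → V}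

lemma IsSpecialCycle.closedAdj_of_not_closedAdj (hG : Chordal G) (hk : 3 ≤ k)
    (h : IsSpecialCycle G.ClosedAdj k x y) (hx : x k = x 0) (hy : y k = y 0)
    (hy01 : ¬ G.ClosedAdj (y 0) (y 1)) (j : ℕ) (hj : j < k) :
    G.ClosedAdj (x j) (x (j + 1)) := by
  induction j using Nat.strong_induction_on with
  | _ j ih =>
    have hxy : ∀ i, G.ClosedAdj (x i) (y i) := fun i => (h i i).2 (by simp)
    have hxy' : ∀ i, G.ClosedAdj (x i) (y (i + 1)) := fun i => (h i (i + 1)).2 (by simp)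
    let W : Set V := {z | (∃ t : ℤ, j + 1 ≤ t ∧ t ≤ k - 1 ∧ z = x t) ∨
      (∃ t : ℤ, j + 2 ≤ t ∧ t ≤ k ∧ z = y t) ∨ ∃ s : ℤ, 0 ≤ s ∧ s < j ∧ z = x s}
    have hWx : ∀ t : ℤ, j + 1 ≤ t → t ≤ k - 1 → x t ∈ W := fun t h1 h2 => Or.inl ⟨t, h1, h2, rfl⟩
    have hWy : ∀ t : ℤ, j + 2 ≤ t → t ≤ k → y t ∈ W :=
      fun t h1 h2 => Or.inr (Or.inl ⟨t, h1, h2, rfl⟩)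
    have hWs : ∀ s : ℤ, 0 ≤ s → s < j → x s ∈ W := fun s h1 h2 => Or.inr (Or.inr ⟨s, h1, h2, rfl⟩)
    let r : V → V → Prop := fun u v => G.ClosedAdj u v ∧ v ∈ W
    have hup : ∀ t : ℕ, j + 1 + t ≤ k - 1 →
        Relation.ReflTransGen r (x (j + 1)) (x (j + 1 + t)) := by
      intro t
      induction t with
      | zero => intro _; simpa using Relation.ReflTransGen.refl
      | succ t iht =>
        intro ht
        have e : (j : ℤ) + 1 + (t + 1 : ℕ) = j + 1 + t + 1 := by push_cast; ring
        rw [e]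
        exact ((iht (by omega)).tail ⟨hxy' _, hWy _ (by omega) (by omega)⟩).tail
          ⟨(hxy _).symm, hWx _ (by omega) (by omega)⟩
    have hdown : ∀ s : ℕ, s < j → Relation.ReflTransGen r (x 0) (x s) := by
      intro s
      induction s with
      | zero => intro _; simpa using Relation.ReflTransGen.refl
      | succ s ihs =>
        intro hs
        refine (ihs (by omega)).tail ⟨?_, hWs _ (by omega) (by omega)⟩
        push_cast
        exact ih s (by omega) (by omega)
    have htoy : j + 2 ≤ k → Relation.ReflTransGen r (x (j + 1)) (y k) := by
      intro hjk
      have h1 := hup (k - j - 2) (by omega)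
      rw [show (j : ℤ) + 1 + (k - j - 2 : ℕ) = k - 1 by omega] at h1
      refine h1.tail ⟨?_, hWy _ (by omega) (by omega)⟩
      have := hxy' (k - 1)
      rwa [sub_add_cancel] at this
    have hlast : 0 < j → G.ClosedAdj (x (j - 1 : ℕ)) (x j) := by
      intro hj0
      have := ih (j - 1) (by omega) (by omega)
      rwa [show ((j - 1 : ℕ) : ℤ) + 1 = j by omega] at this
    have hab : G.ClosedAdj (y (j + 1)) (x j) := (hxy' j).symm
    have hap : G.ClosedAdj (y (j + 1)) (x (j + 1)) := (hxy _).symm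
    obtain ⟨w, hw, h1, h2⟩ :
        ∃ w ∈ W, G.ClosedAdj (y (j + 1)) w ∧ G.ClosedAdj w (x j) := by
      by_cases hj0 : j = 0
      · refine hG.exists_closedAdj hab (hWx _ le_rfl (by omega)) hap (htoy (by omega)) ?_
        rw [hy, hj0]
        exact (hxy 0).symm
      · by_cases hjk : j + 2 ≤ k
        · refine hG.exists_closedAdj hab (hWx _ le_rfl (by omega)) hap
            (((htoy hjk).tail ⟨(hxy k).symm, ?_⟩).trans ?_) (hlast (by omega))
          · rw [hx]
            exact hWs 0 le_rfl (by omega)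
          · rw [hx]
            exact hdown _ (by omega)
        · have hj1 : (j : ℤ) + 1 = k := by omega
          rw [hj1, hx] at hap
          rw [hj1] at hab ⊢
          exact hG.exists_closedAdj hab (hWs 0 le_rfl (by omega)) hap (hdown _ (by omega))
            (hlast (by omega))
    rcases hw with ⟨t, ht1, ht2, rfl⟩ | ⟨t, ht1, ht2, rfl⟩ | ⟨s, hs1, hs2, rfl⟩
    · obtain rfl : t = j + 1 := by
        rcases (h _ _).1 h1.symm with hd | hd
        · have := Int.eq_zero_or_eq_of_dvd hd (by omega) (by omega)
          omega
        · have := Int.eq_zero_or_eq_of_dvd hd (by omega) (by omega)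
          omega
      exact h2.symm
    · exfalso
      have ht : j = 0 ∧ t = k := by
        rcases (h _ _).1 h2.symm with hd | hd
        · have := Int.eq_zero_or_eq_of_dvd hd (by omega) (by omega)
          omega
        · have := Int.eq_zero_or_eq_of_dvd hd (by omega) (by omega)
          omega
      obtain ⟨rfl, rfl⟩ := ht
      rw [hy] at h1
      exact hy01 (by simpa using h1.symm)
    · have hs : s = 0 ∧ (j : ℤ) + 1 = k := by
        rcases (h _ _).1 h1.symm with hd | hd
        · have := Int.eq_zero_or_eq_of_dvd hd (by omega) (by omega)
          omega
        · have := Int.eq_zero_or_eq_of_dvd hd (by omega) (by omega)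
          omega
      rw [hs.2, hx, ← hs.1]
      exact h2.symm

lemma Function.Periodic.map_emod {α : Type*} {f : ℤ → α} {k : ℤ} (hf : Function.Periodic f k)
    (m : ℤ) : f (m % k) = f m := by
  have := hf.int_mul (m / k) (m % k)
  rw [← this]
  congr 1
  have := Int.emod_add_mul_ediv m k
  simp only [Int.cast_id]
  linarith

lemma IsSpecialCycle.closedAdj_left_of_not_closedAdj_right (hG : Chordal G) (hk : 3 ≤ k)
    (h : IsSpecialCycle G.ClosedAdj k x y) (hx : Function.Periodic x k)
    (hy : Function.Periodic y k) {i : ℤ} (hi : ¬ G.ClosedAdj (y i) (y (i + 1))) (m : ℤ) :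
    G.ClosedAdj (x m) (x (m + 1)) := by
  have hpos : (0 : ℤ) < k := by omega
  have h' : IsSpecialCycle G.ClosedAdj k (fun t => x (i + t)) (fun t => y (i + t)) := by
    intro a b
    simpa using h (i + a) (i + b)
  have h1 := Int.emod_nonneg (m - i) hpos.ne'
  have h2 := Int.emod_lt_of_pos (m - i) hpos
  have := h'.closedAdj_of_not_closedAdj hG hk (by simpa using hx i) (by simpa using hy i)
    (by simpa using hi) ((m - i) % k).toNat (by omega)
  rw [Int.toNat_of_nonneg h1] at this
  have hm : ∀ d, x (i + ((m - i) % k + d)) = x (m + d) := by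
    intro d
    rw [← hx.int_mul ((m - i) / k) (i + _)]
    congr 1
    have := Int.emod_add_mul_ediv (m - i) k
    simp only [Int.cast_id]
    linarith
  have h3 := hm 0
  have h4 := hm 1
  rw [add_zero, add_zero] at h3
  rw [h3, h4] at this
  exact this

lemma IsSpecialCycle.swap (h : IsSpecialCycle G.ClosedAdj k x y) :
    IsSpecialCycle G.ClosedAdj k y (fun i => x (i - 1)) := by
  intro i j
  rw [ClosedAdj.comm, h (j - 1) i, or_comm, ← dvd_neg, ← dvd_neg (b := i - (j - 1))]
  ring_nf

end SpecialCycle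

section Sun

variable {V : Type*} {G : SimpleGraph V} {k : ℕ} {x y : ℤ → V}

lemma Int.not_natCast_dvd_one_or_two {k : ℕ} (hk : 3 ≤ k) :
    ¬ (k : ℤ) ∣ 1 ∧ ¬ (k : ℤ) ∣ 2 :=
  ⟨fun h => by have := Int.le_of_dvd one_pos h; omega,
    fun h => by have := Int.le_of_dvd two_pos h; omega⟩

lemma IsSpecialCycle.dvd_of_right_eq (hk : 3 ≤ k) (h : IsSpecialCycle G.ClosedAdj k x y)
    {i j : ℤ} (hij : y j = y i) : (k : ℤ) ∣ j - i := by
  have h1 : G.ClosedAdj (x i) (y j) := hij ▸ (h i i).2 (by simp)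
  have h2 : G.ClosedAdj (x (i - 1)) (y j) := hij ▸ (h (i - 1) i).2 (by simp)
  rw [h] at h1 h2
  rcases h1 with h1 | h1
  · exact h1
  rcases h2 with h2 | h2
  · exact absurd ((dvd_sub h2 h1).trans (dvd_of_eq (by ring))) (Int.not_natCast_dvd_one_or_two hk).2
  · convert h2 using 1; ring

/-- If the columns of a special cycle of closed neighborhoods are consecutively adjacent, then
the rows are pairwise non-adjacent. -/
lemma IsSpecialCycle.not_closedAdj_left (hG : Chordal G) (hk : 3 ≤ k)
    (h : IsSpecialCycle G.ClosedAdj k x y) (hx : Function.Periodic x k)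
    (hyy : ∀ i, G.ClosedAdj (y i) (y (i + 1))) {i j : ℤ} (hij : i < j) (hjk : j < i + k) :
    ¬ G.ClosedAdj (x i) (x j) := by
  have hxy : ∀ i, G.ClosedAdj (x i) (y i) := fun i => (h i i).2 (by simp)
  have key : ∀ i j : ℤ, i < j → j < i + k → G.ClosedAdj (x i) (x j) → j = i + 1 := by
    intro i j hij hjk hadj
    let W : Set V := {z | ∃ t : ℤ, i + 1 ≤ t ∧ t ≤ j ∧ z = y t}
    have hpath : ∀ t : ℕ, i + 1 + t ≤ j → Relation.ReflTransGen
        (fun u v => G.ClosedAdj u v ∧ v ∈ W) (y (i + 1)) (y (i + 1 + t)) := by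
      intro t
      induction t with
      | zero => intro _; simpa using Relation.ReflTransGen.refl
      | succ t iht =>
        intro ht
        push_cast at ht ⊢
        rw [← add_assoc]
        exact (iht (by omega)).tail ⟨hyy _, _, by omega, by omega, rfl⟩
    have h1 := hpath (j - i - 1).toNat (by omega)
    rw [show i + 1 + ((j - i - 1).toNat : ℤ) = j by omega] at h1
    obtain ⟨_, ⟨t, ht1, ht2, rfl⟩, h2, h3⟩ := hG.exists_closedAdj hadj
      (W := W) ⟨i + 1, le_rfl, by omega, rfl⟩ ((h i (i + 1)).2 (by simp)) h1 (hxy j).symm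
    have h3 := h3.symm
    rw [h] at h2 h3
    have ht : t = i + 1 := by
      rcases h2 with hd | hd
      · have := Int.eq_zero_or_eq_of_dvd hd (by omega) (by omega)
        omega
      · have := Int.eq_zero_or_eq_of_dvd hd (by omega) (by omega)
        omega
    rcases h3 with hd | hd
    · have := Int.eq_zero_or_eq_of_dvd (dvd_sub_comm.mp hd) (by omega) (by omega)
      omega
    · have := Int.eq_zero_or_eq_of_dvd (dvd_neg.mpr hd) (by omega) (by omega)
      omega
  intro hadj
  have h1 := key i j hij hjk hadj
  have h2 := key j (i + k) hjk (by omega) (by rw [hx]; exact hadj.symm)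
  omega

lemma IsSpecialCycle.exists_isSun_of_closedAdj_right (hG : Chordal G) (hk : 3 ≤ k)
    (h : IsSpecialCycle G.ClosedAdj k x y) (hx : Function.Periodic x k)
    (hy : Function.Periodic y k) (hyy : ∀ i, G.ClosedAdj (y i) (y (i + 1))) :
    ∃ s : Set V, IsSun (G.induce s) k := by
  have : NeZero k := ⟨by omega⟩
  obtain ⟨hk1, hk2⟩ := Int.not_natCast_dvd_one_or_two hk
  have hne : ∀ i j, x i ≠ y j := by
    intro i j hij
    have h1 : G.ClosedAdj (x i) (y j) := Or.inl hij
    rw [h] at h1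
    rcases h1 with h1 | h1
    · have h2 : G.ClosedAdj (x i) (y (j - 1)) := by
        rw [hij]
        have := hyy (j - 1)
        rw [sub_add_cancel] at this
        exact this.symm
      rw [h] at h2
      rcases h2 with h2 | h2
      · exact hk1 ((dvd_sub h1 h2).trans (dvd_of_eq (by ring)))
      · exact hk2 ((dvd_sub h1 h2).trans (dvd_of_eq (by ring)))
    · have h2 : G.ClosedAdj (x i) (y (j + 1)) := hij ▸ hyy j
      rw [h] at h2
      rcases h2 with h2 | h2
      · exact hk2 ((dvd_sub h2 h1).trans (dvd_of_eq (by ring)))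
      · exact hk1 ((dvd_sub h2 h1).trans (dvd_of_eq (by ring)))
  have hinj : ∀ {i j : Fin k}, (k : ℤ) ∣ (j : ℤ) - i → i = j := by
    intro i j hd
    have := i.2
    have := j.2
    have := Int.eq_zero_of_abs_lt_dvd hd (by rw [abs_lt]; omega)
    omega
  have hyadj : ∀ i, G.Adj (y i) (y (i + 1)) := fun i => (hyy i).adj_of_ne fun heq =>
    hk1 (by simpa using h.dvd_of_right_eq hk heq.symm)
  have hxx : ∀ i j : Fin k, ¬ G.Adj (x i) (x j) := by
    intro i j hadj
    rcases lt_trichotomy i j with hij | rfl | hij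
    · exact h.not_closedAdj_left hG hk hx hyy (i := i) (j := j) (by omega) (by omega)
        (Or.inr hadj)
    · exact hadj.ne rfl
    · exact h.not_closedAdj_left hG hk hx hyy (i := j) (j := i) (by omega) (by omega)
        (Or.inr hadj.symm)
  have hsucc : ∀ i : Fin k, y ((i + 1 : Fin k) : ℕ) = y (i + 1) := by
    intro i
    have h1 : ((1 : Fin k) : ℕ) = 1 := by
      rw [Fin.coe_ofNat_eq_mod, Nat.mod_eq_of_lt (by omega)]
    rw [Fin.val_add, h1, Int.natCast_mod, Nat.cast_add, Nat.cast_one, hy.map_emod]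
  let s : Set V := {z | ∃ i : Fin k, z = y i ∨ z = x i}
  let v : Fin k → s := fun i => ⟨y i, i, Or.inl rfl⟩
  let u : Fin k → s := fun i => ⟨x i, i, Or.inr rfl⟩
  have hvadj : ∀ i : Fin k, (G.induce s).Adj (v i) (v (i + 1)) := by
    intro i
    change G.Adj (y i) (y ((i + 1 : Fin k) : ℕ))
    rw [hsucc]
    exact hyadj i
  have huadj : ∀ (i : Fin k) (z : s), (G.induce s).Adj (u i) z ↔ z = v i ∨ z = v (i + 1) := by
    rintro i ⟨z, j, rfl | rfl⟩
    · rw [Subtype.ext_iff, Subtype.ext_iff]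
      change G.Adj (x i) (y j) ↔ y j = y i ∨ y j = y ((i + 1 : Fin k) : ℕ)
      rw [hsucc]
      constructor
      · intro hadj
        rcases (h _ _).1 (Or.inr hadj) with hd | hd
        · exact Or.inl (by rw [hinj hd])
        · refine Or.inr ?_
          obtain ⟨m, hm⟩ := hd
          rw [← hy.int_mul m (i + 1)]
          congr 1
          simp only [Int.cast_id]
          linarith
      · rintro (heq | heq)
        · rw [heq]
          exact ((h i i).2 (by simp)).adj_of_ne (hne _ _)
        · rw [heq]
          exact ((h i (i + 1)).2 (by simp)).adj_of_ne (hne _ _)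
    · rw [Subtype.ext_iff, Subtype.ext_iff]
      exact iff_of_false (hxx i j) (not_or.mpr ⟨hne _ _, hne _ _⟩)
  refine ⟨s, hk, v, u, fun i j hij => ?_, fun i j hij => ?_, fun i j hij => ?_, ?_, hvadj, huadj,
    ?_⟩
  · exact (hinj (h.dvd_of_right_eq hk (congrArg Subtype.val hij))).symm
  · have := h.swap.dvd_of_right_eq hk (i := i + 1) (j := j + 1)
      (by simpa using (congrArg Subtype.val hij).symm)
    exact hinj (by simpa using this)
  · exact hne j i (congrArg Subtype.val hij).symm
  · rintro ⟨z, i, rfl | rfl⟩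
    · exact Or.inl ⟨i, rfl⟩
    · exact Or.inr ⟨i, rfl⟩
  · intro i z w hz hw hzw
    rw [huadj] at hz hw
    rcases hz with rfl | rfl <;> rcases hw with rfl | rfl
    · exact absurd rfl hzw
    · exact hvadj i
    · exact (hvadj i).symm
    · exact absurd rfl hzw

lemma IsSpecialCycle.exists_isSun (hG : Chordal G) (hk : 3 ≤ k)
    (h : IsSpecialCycle G.ClosedAdj k x y) : ∃ s : Set V, IsSun (G.induce s) k := by
  wlog hper : Function.Periodic x k ∧ Function.Periodic y k generalizing x y
  · refine this (x := fun i => x (i % k)) (y := fun i => y (i % k)) (fun i j => ?_)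
      ⟨fun i => by simp, fun i => by simp⟩
    dsimp only
    rw [h, Int.dvd_iff_emod_eq_zero, Int.dvd_iff_emod_eq_zero, Int.dvd_iff_emod_eq_zero,
      Int.dvd_iff_emod_eq_zero]
    have h1 : (j % k - i % k) % k = (j - i) % (k : ℤ) := by simp [Int.sub_emod]
    have h2 : (j % k - i % k - 1) % k = (j - i - 1) % (k : ℤ) := by
      rw [Int.sub_emod, h1, ← Int.sub_emod]
    rw [h1, h2]
  obtain ⟨hx, hy⟩ := hper
  by_cases hyy : ∀ i, G.ClosedAdj (y i) (y (i + 1))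
  · exact h.exists_isSun_of_closedAdj_right hG hk hx hy hyy
  · push Not at hyy
    obtain ⟨i, hi⟩ := hyy
    have hxx := h.closedAdj_left_of_not_closedAdj_right hG hk hx hy hi
    refine h.swap.exists_isSun_of_closedAdj_right hG hk hy (fun i => ?_) fun i => ?_
    · rw [add_sub_right_comm, hx]
    · have := hxx (i - 1)
      rwa [sub_add_eq_add_sub] at this

end Sun

/-- **Characterization of triangulated S-perfect graphs.** A triangulated graph `G`
is S-perfect if and only if `G` contains no induced subgraph isomorphic to a
`k`-sun with `k` odd, `k ≥ 3`. -/
theorem chordal_SPerfect_iff_oddSunFree {V : Type*} [Fintype V]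
    (G : SimpleGraph V) (hc : Chordal G) :
    SPerfect G ↔ ∀ k : ℕ, Odd k → 3 ≤ k → ∀ s : Set V, ¬ IsSun (G.induce s) k := by
  constructor
  · intro h k hk _ s hs
    classical
    exact hs.alphaS_ne_thetaS hk (h s)
  · intro h s
    classical
    refine alphaS_eq_thetaS_of_balanced fun k hk hk3 x y hxy => ?_
    have hxy' : IsSpecialCycle G.ClosedAdj k (fun i => (x i : V)) (fun i => (y i : V)) := by
      intro i j
      rw [← hxy i j]
      exact or_congr Subtype.ext_iff.symm Iff.rfl
    obtain ⟨t, ht⟩ := hxy'.exists_isSun hc hk3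
    exact h k hk hk3 t ht
end
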